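/- arXiv:1708.07387 — 2 statements merged into one kernel-verified Lean document; each statement's English description precedes it below -/
import Mathlib

section
/- Let μ be the uniform probability measure on the parameter set 𝒬̃ = {(a,f,b,c,d,e,g) ∈ [0,1]² × ℂ⁵ : Q(a,f,b,c,d,e,g) is positive semidefinite} ⊂ ℝ¹². Then the pushforward of μ under the map (a,f,b,c,d,e,g) ↦ √( (Re(b+g))² + (Im(b+g))² + (a+f−1)² ) — the Bloch radius of the image of the maximally mixed state — is the measure on ℝ with Lebesgue density κ(r) = 40 r² (1−r)⁶ (r³ + 6r² + 12r + 2) for r ∈ [0,1] (and 0 outside [0,1]). -/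
open MeasureTheory Matrix Real ComplexOrder

/-- The Choi matrix of a general qubit channel with parameters `(a,f,b,c,d,e,g)`. -/
noncomputable def choiMat (a f : ℝ) (b c d e g : ℂ) : Matrix (Fin 4) (Fin 4) ℂ :=
  !![(a : ℂ), b, c, d;
     star b, 1 - (a : ℂ), e, -c;
     star c, star e, (f : ℂ), g;
     star d, -star c, star g, 1 - (f : ℂ)]

/-- The parameter set of general qubit channels, a Borel subset of `ℝ¹²`. -/
def qubitChannelSet : Set (ℝ × ℝ × ℂ × ℂ × ℂ × ℂ × ℂ) :=
  {p | p.1 ∈ Set.Icc (0 : ℝ) 1 ∧ p.2.1 ∈ Set.Icc (0 : ℝ) 1 ∧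
    (choiMat p.1 p.2.1 p.2.2.1 p.2.2.2.1 p.2.2.2.2.1 p.2.2.2.2.2.1
      p.2.2.2.2.2.2).PosSemidef}

/-- The uniform probability measure on the set of qubit channels. -/
noncomputable def uniformQubitChannel : Measure (ℝ × ℝ × ℂ × ℂ × ℂ × ℂ × ℂ) :=
  (volume qubitChannelSet)⁻¹ • volume.restrict qubitChannelSet

lemma measurePreserving_linear_add {E : Type*} [NormedAddCommGroup E] [NormedSpace ℝ E]
    [MeasurableSpace E] [BorelSpace E] [FiniteDimensional ℝ E] (μ : Measure E)
    [μ.IsAddHaarMeasure] (L : E →ₗ[ℝ] E) (v : E) (hL : Function.Injective L) {S : Set E}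
    (hS : MeasurableSet S) (hpre : (fun x => L x + v) ⁻¹' S = S) (h0 : μ S ≠ 0) (h1 : μ S ≠ ⊤) :
    MeasurePreserving (fun x => L x + v) μ μ := by
  have hdet : LinearMap.det L ≠ 0 := by
    have hb : Function.Bijective L := ⟨hL, LinearMap.surjective_of_injective hL⟩
    have := (LinearEquiv.ofBijective L hb).isUnit_det'
    exact this.ne_zero
  have hLm : Measurable L := L.continuous_of_finiteDimensional.measurable
  have hm : Measurable (fun x => L x + v) := hLm.add_const v
  have hmap : μ.map (fun x => L x + v) = ENNReal.ofReal |(LinearMap.det L)⁻¹| • μ := by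
    have : (fun x => L x + v) = (fun x => x + v) ∘ L := rfl
    rw [this, ← Measure.map_map (measurable_add_const v) hLm,
      Measure.map_linearMap_addHaar_eq_smul_addHaar μ hdet, Measure.map_smul, map_add_right_eq_self]
  refine ⟨hm, ?_⟩
  have hc := congrArg (fun m : Measure E => m S) hmap
  simp only [Measure.map_apply hm hS, hpre, Measure.smul_apply, smul_eq_mul] at hc
  have : ENNReal.ofReal |(LinearMap.det L)⁻¹| = 1 := by
    rw [← ENNReal.mul_eq_right h0 h1]; exact hc.symm
  rw [hmap, this, one_smul]

/-- The linear part of the action of the output unitary `!![α, β; -star β, star α]`. -/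
noncomputable def rotLin (α β : ℂ) :
    (ℝ × ℝ × ℂ × ℂ × ℂ × ℂ × ℂ) →ₗ[ℝ] (ℝ × ℝ × ℂ × ℂ × ℂ × ℂ × ℂ) where
  toFun p :=
    ((Complex.normSq α - Complex.normSq β) * p.1 + 2 * (α * star β * p.2.2.1).re,
     (Complex.normSq α - Complex.normSq β) * p.2.1 + 2 * (α * star β * p.2.2.2.2.2.2).re,
     α ^ 2 * p.2.2.1 - β ^ 2 * star p.2.2.1 - 2 * α * β * p.1,
     (α * star α - β * star β) * p.2.2.2.1 + α * star β * p.2.2.2.2.1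
       + star α * β * p.2.2.2.2.2.1,
     α ^ 2 * p.2.2.2.2.1 - β ^ 2 * p.2.2.2.2.2.1 - 2 * α * β * p.2.2.2.1,
     star α ^ 2 * p.2.2.2.2.2.1 - star β ^ 2 * p.2.2.2.2.1 - 2 * star α * star β * p.2.2.2.1,
     α ^ 2 * p.2.2.2.2.2.2 - β ^ 2 * star p.2.2.2.2.2.2 - 2 * α * β * p.2.1)
  map_add' p q := by
    simp only [Prod.fst_add, Prod.snd_add, Prod.mk_add_mk, Prod.mk.injEq, star_add, mul_add,
      Complex.add_re, Complex.ofReal_add]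
    refine ⟨?_, ?_, ?_, ?_, ?_, ?_, ?_⟩ <;> ring
  map_smul' r p := by
    have hs : ∀ z : ℂ, star ((r : ℂ) * z) = r * star z := fun z => by
      rw [star_mul', Complex.star_def, Complex.conj_ofReal]
    simp only [Prod.smul_fst, Prod.smul_snd, Prod.smul_mk, Prod.mk.injEq, smul_eq_mul,
      RingHom.id_apply, Complex.real_smul, Complex.ofReal_mul, hs]
    have h : ∀ z w : ℂ, (z * (r * w)).re = r * (z * w).re := fun z w => by
      rw [mul_left_comm, Complex.re_ofReal_mul]
    simp only [h]
    refine ⟨?_, ?_, ?_, ?_, ?_, ?_, ?_⟩ <;> ring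

noncomputable def rotShift (α β : ℂ) : ℝ × ℝ × ℂ × ℂ × ℂ × ℂ × ℂ :=
  (Complex.normSq β, Complex.normSq β, α * β, 0, 0, 0, α * β)

/-- The Choi matrix at a point of the parameter space. -/
noncomputable def choiAt (p : ℝ × ℝ × ℂ × ℂ × ℂ × ℂ × ℂ) : Matrix (Fin 4) (Fin 4) ℂ :=
  choiMat p.1 p.2.1 p.2.2.1 p.2.2.2.1 p.2.2.2.2.1 p.2.2.2.2.2.1 p.2.2.2.2.2.2

lemma choiAt_injective : Function.Injective choiAt := by
  rintro ⟨a, f, b, c, d, e, g⟩ ⟨a', f', b', c', d', e', g'⟩ h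
  have H : ∀ i j, choiAt (a, f, b, c, d, e, g) i j = choiAt (a', f', b', c', d', e', g') i j :=
    fun i j => by rw [h]
  have h00 := H 0 0
  have h01 := H 0 1
  have h02 := H 0 2
  have h03 := H 0 3
  have h12 := H 1 2
  have h22 := H 2 2
  have h23 := H 2 3
  simp [choiAt, choiMat] at h00 h01 h02 h03 h12 h22 h23
  simp [*]

def rotMat (α β : ℂ) : Matrix (Fin 4) (Fin 4) ℂ :=
  !![α, β, 0, 0; -star β, star α, 0, 0; 0, 0, α, β; 0, 0, -star β, star α]

lemma choiAt_rot {α β : ℂ} (h : α * star α + β * star β = 1) (p : ℝ × ℝ × ℂ × ℂ × ℂ × ℂ × ℂ) :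
    choiAt (rotLin α β p + rotShift α β) = rotMat α β * choiAt p * star (rotMat α β) := by
  obtain ⟨a, f, b, c, d, e, g⟩ := p
  have hn : ∀ z : ℂ, (Complex.normSq z : ℂ) = z * star z := fun z => (Complex.mul_conj z).symm
  have hr : ∀ z : ℂ, (z.re : ℂ) = (z + star z) / 2 := fun z => Complex.re_eq_add_conj z
  have e1 : star (a : ℂ) = a := Complex.conj_ofReal a
  have e2 : star (f : ℂ) = f := Complex.conj_ofReal f
  ext i j
  fin_cases i <;> fin_cases j <;>
    simp only [choiAt, choiMat, rotMat, rotLin, rotShift, LinearMap.coe_mk, AddHom.coe_mk,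
      Prod.mk_add_mk, Matrix.mul_apply, Fin.sum_univ_four, Matrix.star_eq_conjTranspose,
      Matrix.conjTranspose_apply, Matrix.of_apply, Matrix.cons_val', Matrix.cons_val,
      Matrix.cons_val_zero, Matrix.cons_val_one, Fin.zero_eta, Fin.mk_one, Fin.reduceFinMk,
      star_neg, star_star, star_zero, mul_zero, zero_mul, add_zero, zero_add, 
      Complex.ofReal_add, Complex.ofReal_mul, Complex.ofReal_sub, hn, hr, Complex.ofReal_ofNat,
      e1, e2,      star_add, star_sub, star_mul', star_pow, star_ofNat] <;>
    first
    | ring1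
    | linear_combination h
    | linear_combination -h

lemma isAddHaarMeasure_volume_prod {E F : Type*} [NormedAddCommGroup E] [NormedAddCommGroup F]
    [MeasureSpace E] [MeasureSpace F] [BorelSpace E] [BorelSpace F]
    [SecondCountableTopology E] [SecondCountableTopology F]
    [(volume : Measure E).IsAddHaarMeasure] [(volume : Measure F).IsAddHaarMeasure]
    [SFinite (volume : Measure E)] [SFinite (volume : Measure F)] :
    (volume : Measure (E × F)).IsAddHaarMeasure :=
  Measure.prod.instIsAddHaarMeasure _ _

lemma isAddHaarMeasure_params :
    (volume : Measure (ℝ × ℝ × ℂ × ℂ × ℂ × ℂ × ℂ)).IsAddHaarMeasure := by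
  have := isAddHaarMeasure_volume_prod (E := ℂ) (F := ℂ)
  have := isAddHaarMeasure_volume_prod (E := ℂ) (F := ℂ × ℂ)
  have := isAddHaarMeasure_volume_prod (E := ℂ) (F := ℂ × ℂ × ℂ)
  have := isAddHaarMeasure_volume_prod (E := ℂ) (F := ℂ × ℂ × ℂ × ℂ)
  have := isAddHaarMeasure_volume_prod (E := ℝ) (F := ℂ × ℂ × ℂ × ℂ × ℂ)
  exact isAddHaarMeasure_volume_prod (E := ℝ) (F := ℝ × ℂ × ℂ × ℂ × ℂ × ℂ)

lemma borelSpace_params : BorelSpace (ℝ × ℝ × ℂ × ℂ × ℂ × ℂ × ℂ) := by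
  have : BorelSpace (ℂ × ℂ × ℂ × ℂ × ℂ) := Prod.borelSpace
  have : BorelSpace (ℝ × ℂ × ℂ × ℂ × ℂ × ℂ) := Prod.borelSpace
  exact Prod.borelSpace

lemma mem_qubitChannelSet {p : ℝ × ℝ × ℂ × ℂ × ℂ × ℂ × ℂ} :
    p ∈ qubitChannelSet ↔ (choiAt p).PosSemidef := by
  refine ⟨fun h => h.2.2, fun h => ⟨?_, ?_, h⟩⟩
  · have h0 := h.diag_nonneg (i := 0)
    have h1 := h.diag_nonneg (i := 1)
    simp [choiAt, choiMat] at h0 h1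
    exact ⟨h0, by exact_mod_cast h1⟩
  · have h0 := h.diag_nonneg (i := 2)
    have h1 := h.diag_nonneg (i := 3)
    simp [choiAt, choiMat] at h0 h1
    exact ⟨h0, by exact_mod_cast h1⟩

lemma continuous_choiAt : Continuous choiAt := by
  refine continuous_matrix fun i j => ?_
  fin_cases i <;> fin_cases j <;> simp [choiAt, choiMat] <;> fun_prop

lemma isClosed_setOf_posSemidef {n : Type*} [Fintype n] {X : Type*} [TopologicalSpace X]
    {f : X → Matrix n n ℂ} (hf : Continuous f) : IsClosed {x | (f x).PosSemidef} := by
  simp only [Matrix.posSemidef_iff_dotProduct_mulVec, Set.ofPred_and, Set.ofPred_forall]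
  refine IsClosed.inter ?_ (isClosed_iInter fun x => ?_)
  · exact isClosed_eq hf.matrix_conjTranspose hf
  · exact isClosed_le continuous_const
      (Continuous.dotProduct continuous_const (hf.matrix_mulVec continuous_const))

lemma measurableSet_qubitChannelSet : MeasurableSet qubitChannelSet := by
  have : qubitChannelSet = {p | (choiAt p).PosSemidef} := Set.ext fun p => mem_qubitChannelSet
  rw [this]
  exact (isClosed_setOf_posSemidef continuous_choiAt).measurableSet

lemma isUnit_rotMat {α β : ℂ} (h : α * star α + β * star β = 1) : IsUnit (rotMat α β) := by
  refine IsUnit.of_mul_eq_one (star (rotMat α β)) ?_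
  ext i j
  fin_cases i <;> fin_cases j <;>
    simp [rotMat, Matrix.mul_apply, Fin.sum_univ_four, Matrix.star_eq_conjTranspose,
      Matrix.conjTranspose_apply] <;>
    simp only [Complex.star_def] at h <;>
    first
    | ring1
    | linear_combination h

lemma rot_preimage {α β : ℂ} (h : α * star α + β * star β = 1) :
    (fun p => rotLin α β p + rotShift α β) ⁻¹' qubitChannelSet = qubitChannelSet := by
  ext p
  rw [Set.mem_preimage, mem_qubitChannelSet, mem_qubitChannelSet, choiAt_rot h,
    (isUnit_rotMat h).posSemidef_star_right_conjugate_iff]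

lemma rotLin_injective {α β : ℂ} (h : α * star α + β * star β = 1) :
    Function.Injective (rotLin α β) := by
  intro p q hpq
  have h1 : choiAt (rotLin α β p + rotShift α β) = choiAt (rotLin α β q + rotShift α β) := by
    rw [hpq]
  rw [choiAt_rot h, choiAt_rot h] at h1
  have hu := isUnit_rotMat h
  exact choiAt_injective (hu.mul_left_cancel (hu.star.mul_right_cancel h1))

lemma measurePreserving_rot {α β : ℂ} (h : α * star α + β * star β = 1)
    (h0 : volume qubitChannelSet ≠ 0) (h1 : volume qubitChannelSet ≠ ⊤) :
    MeasurePreserving (fun p => rotLin α β p + rotShift α β)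
      uniformQubitChannel uniformQubitChannel := by
  have := isAddHaarMeasure_params
  have := borelSpace_params
  have h2 := (measurePreserving_linear_add volume (rotLin α β) (rotShift α β)
    (rotLin_injective h) measurableSet_qubitChannelSet (rot_preimage h) h0 h1).restrict_preimage
      measurableSet_qubitChannelSet
  rw [rot_preimage h] at h2
  exact h2.smul_measure _

/-- The Bloch vector of the image of the maximally mixed state, up to a reflection. -/
def blochMap (p : ℝ × ℝ × ℂ × ℂ × ℂ × ℂ × ℂ) : ℂ × ℝ :=
  (p.2.2.1 + p.2.2.2.2.2.2, p.1 + p.2.1 - 1)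

/-- A parametrisation of the rotation taking a given unit vector to the last coordinate axis. -/
lemma exists_rotation_parameters {x y z : ℝ} (h : x ^ 2 + y ^ 2 + z ^ 2 = 1) :
    ∃ α β : ℂ, α * star α + β * star β = 1 ∧ Complex.normSq α - Complex.normSq β = z ∧
      2 * α * star β = x - y * Complex.I := by
  rcases eq_or_ne z (-1) with rfl | hz
  · refine ⟨0, 1, by simp, by simp, ?_⟩
    have hx : x = 0 := by nlinarith [sq_nonneg x, sq_nonneg y]
    have hy : y = 0 := by nlinarith [sq_nonneg x, sq_nonneg y]
    simp [hx, hy]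
  · have hz1 : 0 < 1 + z := by
      have : -1 ≤ z := by nlinarith [sq_nonneg x, sq_nonneg y]
      rcases this.lt_or_eq with h | h
      · linarith
      · exact absurd h.symm hz
    obtain ⟨s, hs, hs2⟩ : ∃ s : ℝ, 0 < s ∧ s ^ 2 = (1 + z) / 2 :=
      ⟨√((1 + z) / 2), by positivity, Real.sq_sqrt (by positivity)⟩
    have hb : Complex.normSq ((x + y * Complex.I) / (2 * s)) = (1 - z) / 2 := by
      rw [Complex.normSq_div, Complex.normSq_add_mul_I, Complex.normSq_mul, Complex.normSq_ofReal,
        Complex.normSq_ofNat, ← sq s, hs2]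
      field_simp
      nlinarith
    have ha : Complex.normSq (s : ℂ) = (1 + z) / 2 := by
      rw [Complex.normSq_ofReal, ← sq, hs2]
    refine ⟨s, (x + y * Complex.I) / (2 * s), ?_, ?_, ?_⟩
    · rw [Complex.star_def, Complex.mul_conj, Complex.mul_conj, ha, hb]
      push_cast; ring
    · rw [ha, hb]; ring
    · have : (s : ℂ) ≠ 0 := by exact_mod_cast hs.ne'
      simp only [Complex.star_def, map_div₀, map_add, map_mul, Complex.conj_ofReal, Complex.conj_I,
        map_ofNat]
      field_simp
      ring

lemma blochMap_rot_snd {α β : ℂ} (h : α * star α + β * star β = 1)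
    (p : ℝ × ℝ × ℂ × ℂ × ℂ × ℂ × ℂ) :
    (blochMap (rotLin α β p + rotShift α β)).2 =
      (Complex.normSq α - Complex.normSq β) * (blochMap p).2
        + (2 * α * star β * (blochMap p).1).re := by
  have hn : Complex.normSq α + Complex.normSq β = 1 := by
    rw [Complex.star_def, Complex.mul_conj, Complex.mul_conj] at h
    exact_mod_cast h
  have h2 : (2 * α * star β * (blochMap p).1).re = 2 * (α * star β * (blochMap p).1).re := by
    rw [mul_assoc, mul_assoc, ← mul_assoc α]
    exact Complex.re_ofReal_mul 2 _
  rw [h2]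
  simp only [blochMap, rotLin, rotShift, LinearMap.coe_mk, AddHom.coe_mk, Prod.mk_add_mk, mul_add,
    Complex.add_re]
  linear_combination hn

/-- The law of every unit-direction coordinate of `μ` is the law of its last coordinate. -/
def IsotropicProjections (μ : Measure (ℂ × ℝ)) : Prop :=
  ∀ x y z : ℝ, x ^ 2 + y ^ 2 + z ^ 2 = 1 →
    μ.map (fun v => x * v.1.re + y * v.1.im + z * v.2) = μ.map Prod.snd

lemma exists_unit_direction (p q r : ℝ) :
    ∃ s x y z : ℝ, x ^ 2 + y ^ 2 + z ^ 2 = 1 ∧ p = s * x ∧ q = s * y ∧ r = s * z := by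
  by_cases h : p ^ 2 + q ^ 2 + r ^ 2 = 0
  · have hp : p = 0 := by nlinarith [sq_nonneg p, sq_nonneg q, sq_nonneg r]
    have hq : q = 0 := by nlinarith [sq_nonneg p, sq_nonneg q, sq_nonneg r]
    have hr : r = 0 := by nlinarith [sq_nonneg p, sq_nonneg q, sq_nonneg r]
    exact ⟨0, 0, 0, 1, by norm_num, by simp [hp], by simp [hq], by simp [hr]⟩
  · have hpos : 0 < p ^ 2 + q ^ 2 + r ^ 2 := lt_of_le_of_ne (by positivity) (Ne.symm h)
    have hs : 0 < √(p ^ 2 + q ^ 2 + r ^ 2) := Real.sqrt_pos.2 hpos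
    have hs2 := Real.sq_sqrt hpos.le
    set s := √(p ^ 2 + q ^ 2 + r ^ 2)
    refine ⟨s, p / s, q / s, r / s, ?_, ?_, ?_, ?_⟩
    · field_simp
      linarith
    all_goals field_simp

lemma IsotropicProjections.ext {μ ν : Measure (ℂ × ℝ)} [IsFiniteMeasure μ] [IsFiniteMeasure ν]
    (hμ : IsotropicProjections μ) (hν : IsotropicProjections ν)
    (h : μ.map Prod.snd = ν.map Prod.snd) : μ = ν := by
  refine Measure.ext_of_charFunDual (funext fun ℓ => ?_)
  obtain ⟨s, x, y, z, hu, hx, hy, hz⟩ := exists_unit_direction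
    (ℓ ((1, 0) : ℂ × ℝ)) (ℓ ((Complex.I, 0) : ℂ × ℝ)) (ℓ ((0, 1) : ℂ × ℝ))
  have hℓ : ∀ v : ℂ × ℝ, ℓ v = s * (x * v.1.re + y * v.1.im + z * v.2) := by
    rintro ⟨w, t⟩
    have hv : ((w, t) : ℂ × ℝ) = w.re • ((1, 0) : ℂ × ℝ) + w.im • ((Complex.I, 0) : ℂ × ℝ)
        + t • ((0, 1) : ℂ × ℝ) := by
      ext <;> simp
    rw [hv, map_add, map_add, map_smul, map_smul, map_smul, hx, hy, hz, ← hv]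
    simp only [smul_eq_mul]
    ring
  have key : ∀ m : Measure (ℂ × ℝ), IsotropicProjections m →
      charFunDual m ℓ = ∫ t : ℝ, Complex.exp ((s * t : ℝ) * Complex.I) ∂(m.map Prod.snd) := by
    intro m hm
    rw [charFunDual_apply, ← hm x y z hu, integral_map]
    · simp only [hℓ]
    · fun_prop
    · exact Continuous.aestronglyMeasurable (by fun_prop)
  rw [key μ hμ, key ν hν, h]

lemma isotropicProjections_map {Ω : Type*} [MeasurableSpace Ω] {P : Measure Ω} {V : Ω → ℂ × ℝ}
    (hV : Measurable V)
    (h : ∀ α β : ℂ, α * star α + β * star β = 1 → ∃ T : Ω → Ω, MeasurePreserving T P P ∧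
      ∀ p, (V (T p)).2 = (Complex.normSq α - Complex.normSq β) * (V p).2
        + (2 * α * star β * (V p).1).re) :
    IsotropicProjections (P.map V) := by
  intro x y z hu
  obtain ⟨α, β, h1, h2, h3⟩ := exists_rotation_parameters hu
  obtain ⟨T, hT, hVT⟩ := h α β h1
  rw [Measure.map_map (by fun_prop) hV, Measure.map_map measurable_snd hV]
  conv_rhs => rw [← hT.map_eq]
  rw [Measure.map_map (measurable_snd.comp hV) hT.measurable]
  congr 1
  ext p
  simp only [Function.comp_apply, hVT, h2, h3]
  simp
  ring

lemma isAddHaarMeasure_complex_prod_real : (volume : Measure (ℂ × ℝ)).IsAddHaarMeasure :=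
  isAddHaarMeasure_volume_prod

/-- The rotation of Bloch vectors induced by the unitary `!![α, β; -star β, star α]`. -/
noncomputable def blochRot (α β : ℂ) : (ℂ × ℝ) →ₗ[ℝ] (ℂ × ℝ) where
  toFun v := (α ^ 2 * v.1 - β ^ 2 * star v.1 - 2 * α * β * v.2,
    (Complex.normSq α - Complex.normSq β) * v.2 + (2 * α * star β * v.1).re)
  map_add' p q := by
    simp only [Prod.fst_add, Prod.snd_add, Prod.mk_add_mk, Prod.mk.injEq, star_add, mul_add,
      Complex.add_re, Complex.ofReal_add]
    refine ⟨?_, ?_⟩ <;> ring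
  map_smul' r p := by
    have hs : ∀ z : ℂ, star ((r : ℂ) * z) = r * star z := fun z => by
      rw [star_mul', Complex.star_def, Complex.conj_ofReal]
    simp only [Prod.smul_fst, Prod.smul_snd, Prod.smul_mk, Prod.mk.injEq, smul_eq_mul,
      RingHom.id_apply, Complex.real_smul, Complex.ofReal_mul, hs]
    have h : ∀ z w : ℂ, (z * (r * w)).re = r * (z * w).re := fun z w => by
      rw [mul_left_comm, Complex.re_ofReal_mul]
    simp only [h]
    refine ⟨?_, ?_⟩ <;> ring

lemma normSq_blochRot {α β : ℂ} (h : α * star α + β * star β = 1) (v : ℂ × ℝ) :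
    Complex.normSq (blochRot α β v).1 + (blochRot α β v).2 ^ 2 =
      Complex.normSq v.1 + v.2 ^ 2 := by
  have hn : Complex.normSq α + Complex.normSq β = 1 := by
    rw [Complex.star_def, Complex.mul_conj, Complex.mul_conj] at h
    exact_mod_cast h
  obtain ⟨⟨x, y⟩, t⟩ := v
  obtain ⟨a1, a2⟩ := α
  obtain ⟨b1, b2⟩ := β
  simp only [blochRot, LinearMap.coe_mk, AddHom.coe_mk, Complex.normSq_apply, Complex.mul_re,
    Complex.mul_im, Complex.sub_re, Complex.sub_im, Complex.star_def, Complex.conj_re,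
    Complex.conj_im, Complex.ofReal_re, Complex.ofReal_im, Complex.re_ofNat, Complex.im_ofNat,
    pow_two] at hn ⊢
  have hn2 : (a1 * a1 + a2 * a2 + (b1 * b1 + b2 * b2)) ^ 2 = 1 := by rw [hn]; norm_num
  linear_combination (x ^ 2 + y ^ 2 + t ^ 2) * hn2

lemma measurePreserving_blochRot {α β : ℂ} (h : α * star α + β * star β = 1) :
    MeasurePreserving (blochRot α β) volume volume := by
  have := isAddHaarMeasure_complex_prod_real
  have hinj : Function.Injective (blochRot α β) := by
    rw [← LinearMap.ker_eq_bot, LinearMap.ker_eq_bot']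
    intro v hv
    have h1 := normSq_blochRot h v
    rw [hv] at h1
    simp only [Prod.fst_zero, Prod.snd_zero, map_zero] at h1
    have h2 : Complex.normSq v.1 = 0 := by
      nlinarith [Complex.normSq_nonneg v.1, sq_nonneg v.2]
    have h3 : v.2 = 0 := by
      nlinarith [Complex.normSq_nonneg v.1, sq_nonneg v.2]
    exact Prod.ext (Complex.normSq_eq_zero.1 h2) h3
  set S : Set (ℂ × ℝ) := {v | Complex.normSq v.1 + v.2 ^ 2 < 1}
  have hcont : Continuous fun v : ℂ × ℝ => Complex.normSq v.1 + v.2 ^ 2 :=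
    (Complex.continuous_normSq.comp continuous_fst).add (continuous_snd.pow 2)
  have hS : IsOpen S := isOpen_lt hcont continuous_const
  have h0 : volume S ≠ 0 := (hS.measure_pos volume ⟨0, by simp [S]⟩).ne'
  have hb : Bornology.IsBounded S := by
    refine (Metric.isBounded_closedBall (x := (0 : ℂ × ℝ)) (r := 1)).subset fun v hv => ?_
    have hv' : Complex.normSq v.1 + v.2 ^ 2 < 1 := hv
    rw [mem_closedBall_zero_iff, Prod.norm_def, max_le_iff]
    constructor
    · rw [← sq_le_one_iff₀ (norm_nonneg _), ← Complex.normSq_eq_norm_sq]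
      nlinarith [sq_nonneg v.2]
    · rw [← sq_le_one_iff₀ (norm_nonneg _), Real.norm_eq_abs, sq_abs]
      nlinarith [Complex.normSq_nonneg v.1]
  have := measurePreserving_linear_add volume (blochRot α β) 0 hinj hS.measurableSet
    (by ext v; simp only [S, add_zero, Set.mem_preimage, Set.mem_ofPred_eq, normSq_blochRot h])
    h0 hb.measure_lt_top.ne
  simpa only [add_zero] using this

/-- The norm of a Bloch vector. -/
noncomputable def blochNorm (v : ℂ × ℝ) : ℝ := √(Complex.normSq v.1 + v.2 ^ 2)

lemma measurable_blochNorm : Measurable blochNorm := by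
  have hcont : Continuous fun v : ℂ × ℝ => Complex.normSq v.1 + v.2 ^ 2 :=
    (Complex.continuous_normSq.comp continuous_fst).add (continuous_snd.pow 2)
  exact hcont.sqrt.measurable

lemma isotropicProjections_radial {k : ℝ → ENNReal} (hk : Measurable k) :
    IsotropicProjections (volume.withDensity fun v : ℂ × ℝ => k (blochNorm v)) := by
  rw [← Measure.map_id (μ := volume.withDensity fun v : ℂ × ℝ => k (blochNorm v))]
  refine isotropicProjections_map measurable_id fun α β h => ⟨blochRot α β, ?_, fun p => rfl⟩
  have hT := measurePreserving_blochRot h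
  refine ⟨hT.measurable, Measure.ext fun s hs => ?_⟩
  have hpre := hT.setLIntegral_comp_preimage hs (hk.comp measurable_blochNorm)
  simp only [Function.comp_apply, blochNorm, normSq_blochRot h] at hpre
  rw [Measure.map_apply hT.measurable hs, withDensity_apply _ (hT.measurable hs),
    withDensity_apply _ hs]
  exact hpre

lemma lintegral_Ioo_eq_sub {F f : ℝ → ℝ} {a b : ℝ} (hab : a ≤ b)
    (hF : ∀ x, HasDerivAt F (f x) x) (hf : Continuous f) (hpos : ∀ x ∈ Set.Ioo a b, 0 ≤ f x) :
    ∫⁻ x in Set.Ioo a b, ENNReal.ofReal (f x) = ENNReal.ofReal (F b - F a) := by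
  rw [← intervalIntegral.integral_eq_sub_of_hasDerivAt (fun x _ => hF x)
    (hf.intervalIntegrable _ _), intervalIntegral.integral_of_le hab, integral_Ioc_eq_integral_Ioo,
    ofReal_integral_eq_lintegral_ofReal]
  · exact (hf.integrableOn_Icc).mono_set Set.Ioo_subset_Icc_self
  · exact (ae_restrict_iff' measurableSet_Ioo).2 (Filter.Eventually.of_forall hpos)

lemma lintegral_blochNorm {F : ℝ → ENNReal} (hF : Measurable F) (z : ℝ) :
    ∫⁻ w : ℂ, F (blochNorm (w, z)) =
      ENNReal.ofReal (2 * π) * ∫⁻ r in Set.Ioi |z|, ENNReal.ofReal r * F r := by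
  have himg : (fun r : ℝ => √(r ^ 2 + z ^ 2)) '' Set.Ioi 0 = Set.Ioi |z| := by
    ext s
    simp only [Set.mem_image, Set.mem_Ioi]
    constructor
    · rintro ⟨r, hr, rfl⟩
      exact Real.lt_sqrt_of_sq_lt (by rw [sq_abs]; nlinarith)
    · intro hs
      have hs0 : 0 < s := (abs_nonneg z).trans_lt hs
      have h2 : z ^ 2 < s ^ 2 := by
        rw [← sq_abs]; exact pow_lt_pow_left₀ hs (abs_nonneg z) two_ne_zero
      refine ⟨√(s ^ 2 - z ^ 2), Real.sqrt_pos.2 (by linarith), ?_⟩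
      rw [Real.sq_sqrt (by linarith), sub_add_cancel, Real.sqrt_sq hs0.le]
  have hpos : ∀ r ∈ Set.Ioi (0 : ℝ), 0 < r ^ 2 + z ^ 2 := fun r hr => by
    have : 0 < r := hr
    positivity
  have hsub := lintegral_image_eq_lintegral_abs_deriv_mul (s := Set.Ioi 0)
    (f := fun r : ℝ => √(r ^ 2 + z ^ 2)) (f' := fun r => r / √(r ^ 2 + z ^ 2)) measurableSet_Ioi
    (fun r hr => by
      have h1 : HasDerivAt (fun r : ℝ => r ^ 2 + z ^ 2) (2 * r) r := by
        simpa using (hasDerivAt_pow 2 r).add_const (z ^ 2)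
      have h2 := (h1.sqrt (hpos r hr).ne').hasDerivWithinAt (s := Set.Ioi 0)
      exact h2.congr_deriv (mul_div_mul_left _ _ two_ne_zero))
    (fun r hr s hs h => by
      have h2 := congrArg (fun t => t ^ 2) h
      simp only [Real.sq_sqrt (hpos r hr).le, Real.sq_sqrt (hpos s hs).le] at h2
      have hr' : 0 < r := hr
      have hs' : 0 < s := hs
      nlinarith)
    (fun r => ENNReal.ofReal r * F r)
  rw [himg] at hsub
  have hm : Measurable fun r : ℝ => ENNReal.ofReal r * F √(r ^ 2 + z ^ 2) :=
    ENNReal.measurable_ofReal.mul (hF.comp (by fun_prop))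
  rw [← Complex.lintegral_comp_polarCoord_symm, hsub, polarCoord_target,
    Measure.volume_eq_prod, ← Measure.prod_restrict, lintegral_prod _ ?_]
  · have : ∀ (r θ : ℝ), ENNReal.ofReal r • F (blochNorm (Complex.polarCoord.symm (r, θ), z)) =
        ENNReal.ofReal r * F √(r ^ 2 + z ^ 2) := by
      intro r θ
      rw [smul_eq_mul, blochNorm, Complex.normSq_eq_norm_sq, Complex.norm_polarCoord_symm, sq_abs]
    simp only [this, lintegral_const, Measure.restrict_apply MeasurableSet.univ, Set.univ_inter,
      Real.volume_Ioo, sub_neg_eq_add, ← two_mul]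
    rw [lintegral_mul_const _ hm, mul_comm]
    congr 1
    refine setLIntegral_congr_fun measurableSet_Ioi fun r hr => ?_
    have hr' : 0 < r := hr
    have h3 : 0 < √(r ^ 2 + z ^ 2) := Real.sqrt_pos.2 (hpos r hr)
    rw [← mul_assoc, ← ENNReal.ofReal_mul (abs_nonneg _), abs_of_pos (div_pos hr' h3),
      div_mul_cancel₀ _ h3.ne']
  · refine Measurable.aemeasurable ?_
    simp only [smul_eq_mul]
    refine (ENNReal.measurable_ofReal.comp measurable_fst).mul (hF.comp ?_)
    simp only [blochNorm, Complex.normSq_eq_norm_sq, Complex.norm_polarCoord_symm]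
    fun_prop

/-- The density, on the Bloch ball, of the Bloch vector of the image of the maximally mixed
state, as a function of the Bloch radius. -/
noncomputable def blochDensity (r : ℝ) : ENNReal :=
  if r < 1 then ENNReal.ofReal (10 / π * ((1 - r) ^ 6 * (r ^ 3 + 6 * r ^ 2 + 12 * r + 2))) else 0

/-- The marginal density of a coordinate of the Bloch vector. -/
noncomputable def coordDensity (z : ℝ) : ENNReal :=
  if |z| < 1 then ENNReal.ofReal (20 / 11 * ((1 - |z|) ^ 7 *
    ((1 - |z|) ^ 4 + 11 * |z| * (1 - |z|) ^ 2 + 33 * |z| ^ 2))) else 0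

lemma measurable_blochDensity : Measurable blochDensity :=
  Measurable.ite measurableSet_Iio (by fun_prop) measurable_const

lemma measurable_coordDensity : Measurable coordDensity :=
  Measurable.ite (measurableSet_lt (by fun_prop) measurable_const) (by fun_prop) measurable_const

lemma lintegral_blochDensity_tail (z : ℝ) :
    ENNReal.ofReal (2 * π) * ∫⁻ r in Set.Ioi |z|, ENNReal.ofReal r * blochDensity r =
      coordDensity z := by
  have h1 : ∫⁻ r in Set.Ioi |z|, ENNReal.ofReal r * blochDensity r =
      ∫⁻ r in Set.Ioo |z| 1, ENNReal.ofReal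
        (10 / π * (r * ((1 - r) ^ 6 * (r ^ 3 + 6 * r ^ 2 + 12 * r + 2)))) := by
    rw [← lintegral_indicator measurableSet_Ioi, ← lintegral_indicator measurableSet_Ioo]
    refine lintegral_congr fun r => ?_
    by_cases hr : |z| < r
    · have hr0 : 0 ≤ r := (abs_nonneg z).trans hr.le
      by_cases hr1 : r < 1
      · rw [Set.indicator_of_mem (Set.mem_Ioi.2 hr), Set.indicator_of_mem (Set.mem_Ioo.2 ⟨hr, hr1⟩),
          blochDensity, if_pos hr1, ← ENNReal.ofReal_mul hr0]
        congr 1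
        ring
      · rw [Set.indicator_of_mem (Set.mem_Ioi.2 hr),
          Set.indicator_of_notMem (fun h => hr1 (Set.mem_Ioo.1 h).2),
          blochDensity, if_neg hr1, mul_zero]
    · rw [Set.indicator_of_notMem (fun h => hr (Set.mem_Ioi.1 h)),
        Set.indicator_of_notMem (fun h => hr (Set.mem_Ioo.1 h).1)]
  rw [h1, coordDensity]
  split_ifs with hz
  · rw [lintegral_Ioo_eq_sub (F := fun r => -(1 / π) * (10 / 11) * ((1 - r) ^ 7 *
        ((1 - r) ^ 4 + 11 * r * (1 - r) ^ 2 + 33 * r ^ 2))) hz.le]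
    · rw [← ENNReal.ofReal_mul (by positivity)]
      congr 1
      have := Real.pi_ne_zero
      field_simp
      ring
    · intro r
      have hp := fun n : ℕ => ((hasDerivAt_id' r).const_sub 1).fun_pow n
      have h2 := (((hp 7).fun_mul (((hp 4).fun_add
        (((hasDerivAt_id' r).const_mul 11).fun_mul (hp 2))).fun_add
        ((hasDerivAt_pow 2 r).const_mul 33)))).const_mul (-(1 / π) * (10 / 11))
      refine h2.congr_deriv ?_
      push_cast
      ring
    · fun_prop
    · intro r hr
      have : 0 ≤ r := (abs_nonneg z).trans hr.1.le
      have : 0 ≤ 1 - r := by linarith [hr.2]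
      positivity
  · rw [Set.Ioo_eq_empty hz, Measure.restrict_empty, lintegral_zero_measure, mul_zero]

/-- The law on the Bloch ball with density `blochDensity`. -/
noncomputable def blochLaw : Measure (ℂ × ℝ) :=
  volume.withDensity fun v => blochDensity (blochNorm v)

lemma lintegral_blochLaw {F : ℂ × ℝ → ENNReal} (hF : Measurable F) :
    ∫⁻ v, F v ∂blochLaw = ∫⁻ z : ℝ, ∫⁻ w : ℂ, blochDensity (blochNorm (w, z)) * F (w, z) := by
  have hm : Measurable fun v : ℂ × ℝ => blochDensity (blochNorm v) :=
    measurable_blochDensity.comp measurable_blochNorm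
  rw [blochLaw, lintegral_withDensity_eq_lintegral_mul _ hm hF, Measure.volume_eq_prod,
    lintegral_prod_symm _ (hm.mul hF).aemeasurable]
  simp only [Pi.mul_apply]

lemma map_snd_blochLaw : blochLaw.map Prod.snd = volume.withDensity coordDensity := by
  refine Measure.ext_of_lintegral _ fun G hG => ?_
  rw [lintegral_map hG measurable_snd,
    lintegral_blochLaw (F := fun v => G v.2) (hG.comp measurable_snd),
    lintegral_withDensity_eq_lintegral_mul _ measurable_coordDensity hG]
  refine lintegral_congr fun z => ?_
  simp only [Pi.mul_apply]
  rw [lintegral_mul_const _ (by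
    exact measurable_blochDensity.comp (measurable_blochNorm.comp measurable_prodMk_right)),
    lintegral_blochNorm measurable_blochDensity, lintegral_blochDensity_tail]

lemma map_blochNorm_blochLaw :
    blochLaw.map blochNorm = volume.withDensity (fun r : ℝ => if 0 ≤ r ∧ r ≤ 1 then
      ENNReal.ofReal (40 * r ^ 2 * (1 - r) ^ 6 * (r ^ 3 + 6 * r ^ 2 + 12 * r + 2)) else 0) := by
  have hκ : Measurable (fun r : ℝ => if 0 ≤ r ∧ r ≤ 1 then
      ENNReal.ofReal (40 * r ^ 2 * (1 - r) ^ 6 * (r ^ 3 + 6 * r ^ 2 + 12 * r + 2)) else 0) :=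
    Measurable.ite (measurableSet_Icc (a := (0 : ℝ)) (b := 1)) (by fun_prop) measurable_const
  refine Measure.ext_of_lintegral _ fun G hG => ?_
  rw [lintegral_map hG measurable_blochNorm, 
    lintegral_blochLaw (F := fun v => G (blochNorm v)) (hG.comp measurable_blochNorm),
    lintegral_withDensity_eq_lintegral_mul _ hκ hG]
  have hm : Measurable fun r : ℝ => ENNReal.ofReal r * (blochDensity r * G r) :=
    ENNReal.measurable_ofReal.mul (measurable_blochDensity.mul hG)
  calc ∫⁻ z : ℝ, ∫⁻ w : ℂ, blochDensity (blochNorm (w, z)) * G (blochNorm (w, z))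
      = ∫⁻ z : ℝ, ENNReal.ofReal (2 * π) *
          ∫⁻ r in Set.Ioi |z|, ENNReal.ofReal r * (blochDensity r * G r) :=
        lintegral_congr fun z => lintegral_blochNorm (measurable_blochDensity.mul hG) z
    _ = ENNReal.ofReal (2 * π) * ∫⁻ z : ℝ, ∫⁻ r : ℝ,
          {p : ℝ × ℝ | |p.1| < p.2}.indicator
            (fun p => ENNReal.ofReal p.2 * (blochDensity p.2 * G p.2)) (z, r) := by
        rw [lintegral_const_mul' _ _ ENNReal.ofReal_ne_top]
        congr 1
        refine lintegral_congr fun z => ?_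
        rw [← lintegral_indicator measurableSet_Ioi]
        rfl
    _ = ENNReal.ofReal (2 * π) * ∫⁻ r : ℝ, ∫⁻ z : ℝ,
          {p : ℝ × ℝ | |p.1| < p.2}.indicator
            (fun p => ENNReal.ofReal p.2 * (blochDensity p.2 * G p.2)) (z, r) := by
        rw [lintegral_lintegral_swap]
        exact ((hm.comp measurable_snd).indicator
          (measurableSet_lt (by fun_prop) measurable_snd)).aemeasurable
    _ = ENNReal.ofReal (2 * π) * ∫⁻ r : ℝ,
          ENNReal.ofReal r * (blochDensity r * G r) * ENNReal.ofReal (2 * r) := by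
        congr 1
        refine lintegral_congr fun r => ?_
        have : (fun z : ℝ => {p : ℝ × ℝ | |p.1| < p.2}.indicator
            (fun p => ENNReal.ofReal p.2 * (blochDensity p.2 * G p.2)) (z, r)) =
            (Set.Ioo (-r) r).indicator fun _ => ENNReal.ofReal r * (blochDensity r * G r) := by
          ext z
          simp only [Set.indicator, Set.mem_ofPred_eq, Set.mem_Ioo, abs_lt]
        rw [this, lintegral_indicator measurableSet_Ioo, lintegral_const,
          Measure.restrict_apply MeasurableSet.univ, Set.univ_inter, Real.volume_Ioo]
        congr 2
        ring
    _ = _ := by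
        rw [← lintegral_const_mul' _ _ ENNReal.ofReal_ne_top]
        refine lintegral_congr fun r => ?_
        simp only [Pi.mul_apply]
        rcases lt_or_ge r 0 with h0 | h0
        · rw [ENNReal.ofReal_of_nonpos h0.le, if_neg (fun h => h0.not_ge h.1)]
          simp
        · rcases lt_trichotomy r 1 with h1 | h1 | h1
          · rw [blochDensity, if_pos h1, if_pos ⟨h0, h1.le⟩]
            rw [show ∀ a b c d e : ENNReal, a * (b * (c * d) * e) = (a * b * c * e) * d from
              fun a b c d e => by ring, ← ENNReal.ofReal_mul (by positivity),
              ← ENNReal.ofReal_mul (by positivity), ← ENNReal.ofReal_mul]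
            · congr 2
              have := Real.pi_ne_zero
              field_simp
              ring
            · have : 0 ≤ 1 - r := by linarith
              positivity
          · subst h1
            simp [blochDensity]
          · rw [blochDensity, if_neg h1.not_gt, if_neg (fun h => h1.not_ge h.2)]
            simp

lemma lintegral_complex_affine (F : ℂ → ENNReal) {s : ℝ} (hs : s ≠ 0) (t : ℂ) :
    ∫⁻ w, F w = ENNReal.ofReal (s ^ 2) * ∫⁻ w : ℂ, F (s * w + t) := by
  have h := (Homeomorph.smulOfNeZero s hs (α := ℂ)).measurableEmbedding.lintegral_map
    (μ := volume) (fun w => F (w + t))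
  simp only [Homeomorph.smulOfNeZero_apply, Complex.real_smul] at h
  rw [← h, show (fun w : ℂ => (s : ℂ) * w) = (s • ·) from rfl,
    Measure.map_addHaar_smul _ hs, lintegral_smul_measure, Complex.finrank_real_complex,
    lintegral_add_right_eq_self, smul_eq_mul, ← mul_assoc, ← ENNReal.ofReal_mul (sq_nonneg s),
    abs_inv, abs_of_nonneg (sq_nonneg s), mul_inv_cancel₀ (pow_ne_zero 2 hs), ENNReal.ofReal_one,
    one_mul]

/-- The block contraction matrix, with both diagonal blocks the identity. -/
def contractionMat (k l m n : ℂ) : Matrix (Fin 4) (Fin 4) ℂ :=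
  !![1, k, 0, l; star k, 1, m, 0; 0, star m, 1, n; star l, 0, star n, 1]

/-- The indicator function of the set of completely positive parameters. -/
noncomputable def channelInd : ℝ × ℝ × ℂ × ℂ × ℂ × ℂ × ℂ → ENNReal :=
  qubitChannelSet.indicator 1

open scoped Classical in
/-- The volume of the set of contractions. -/
noncomputable def contractionVolume : ENNReal :=
  ∫⁻ k : ℂ, ∫⁻ l : ℂ, ∫⁻ m : ℂ, ∫⁻ n : ℂ,
    if (contractionMat k l m n).PosSemidef then 1 else 0

/-- The block lower triangular Cholesky-type factor of the Choi matrix. -/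
def cholMat (α β δ η : ℝ) (γ ε : ℂ) : Matrix (Fin 4) (Fin 4) ℂ :=
  !![(α : ℂ), 0, 0, 0; 0, (β : ℂ), 0, 0; γ, 0, (δ : ℂ), 0; 0, ε, 0, (η : ℂ)]

lemma isUnit_cholMat {α β δ η : ℝ} (hα : α ≠ 0) (hβ : β ≠ 0) (hδ : δ ≠ 0) (hη : η ≠ 0)
    (γ ε : ℂ) : IsUnit (cholMat α β δ η γ ε) := by
  rw [Matrix.isUnit_iff_isUnit_det, Matrix.det_of_isLowerTriangular _ ?_, Fin.prod_univ_four]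
  · simp [cholMat, hα, hβ, hδ, hη]
  · intro i j hij
    rw [OrderDual.toDual_lt_toDual] at hij
    fin_cases i <;> fin_cases j <;> simp [cholMat] at hij ⊢

lemma choiAt_chol {a f : ℝ} {c : ℂ} {α β δ η : ℝ} {γ ε : ℂ} (ha : α ^ 2 = a)
    (ha' : β ^ 2 = 1 - a) (hf : Complex.normSq γ + δ ^ 2 = f)
    (hf' : Complex.normSq ε + η ^ 2 = 1 - f) (hc : α * star γ = c) (hc' : β * star ε = -c)
    (k l m n : ℂ) :
    choiAt (a, f, (α * β : ℝ) * k, c, (α * η : ℝ) * l + α * star ε * k,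
        (β * δ : ℝ) * m + β * star γ * star k,
        (δ * η : ℝ) * n + (star ε * (γ * k + δ * star m) + η * γ * l)) =
      cholMat α β δ η γ ε * contractionMat k l m n * star (cholMat α β δ η γ ε) := by
  have e0 : ∀ x : ℝ, star (x : ℂ) = x := fun x => Complex.conj_ofReal x
  have hn : ∀ z : ℂ, (Complex.normSq z : ℂ) = z * star z := fun z => (Complex.mul_conj z).symm
  have h1 : (1 : ℂ) - a = β ^ 2 := by rw [← Complex.ofReal_pow, ha']; push_cast; ring
  have h2 : (1 : ℂ) - f = ε * star ε + η ^ 2 := by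
    rw [← hn, ← Complex.ofReal_pow, ← Complex.ofReal_add, hf']; push_cast; ring
  have h3 : star c = α * γ := by rw [← hc, star_mul', star_star, e0]
  have h4 : -star c = β * ε := by rw [← star_neg, ← hc', star_mul', star_star, e0]
  have h5 : (a : ℂ) = α ^ 2 := by rw [← ha]; push_cast; ring
  have h6 : (f : ℂ) = γ * star γ + δ ^ 2 := by rw [← hf]; push_cast; rw [hn]
  ext i j
  fin_cases i <;> fin_cases j <;>
    simp only [choiAt, choiMat, cholMat, contractionMat, Matrix.mul_apply, Fin.sum_univ_four,
      Matrix.star_eq_conjTranspose, Matrix.conjTranspose_apply, Matrix.of_apply, Matrix.cons_val',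
      Matrix.cons_val, Matrix.cons_val_zero, Matrix.cons_val_one, Fin.zero_eta, Fin.mk_one,
      Fin.reduceFinMk, star_star, star_zero, mul_zero, zero_mul, add_zero, zero_add,
      Complex.ofReal_mul, e0, star_add, star_mul'] <;>
    first
    | ring1
    | linear_combination h1
    | linear_combination h2
    | linear_combination h3
    | linear_combination h4
    | linear_combination h5
    | linear_combination h6
    | linear_combination -hc
    | linear_combination -hc'

lemma lintegral_channelInd_of_lt {a f : ℝ} {c : ℂ} (ha : 0 ≤ a) (ha' : a ≤ 1)
    (h : ‖c‖ ^ 2 < a * f) (h' : ‖c‖ ^ 2 < (1 - a) * (1 - f)) :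
    ∫⁻ b : ℂ, ∫⁻ d : ℂ, ∫⁻ e : ℂ, ∫⁻ g : ℂ, channelInd (a, f, b, c, d, e, g) =
      ENNReal.ofReal ((a * f - ‖c‖ ^ 2) ^ 2 * ((1 - a) * (1 - f) - ‖c‖ ^ 2) ^ 2) *
        contractionVolume := by
  have ha0 : 0 < a := lt_of_le_of_ne ha fun h0 => by
    rw [← h0, zero_mul] at h; exact h.not_ge (sq_nonneg _)
  have ha1 : 0 < 1 - a := lt_of_le_of_ne (by linarith) fun h0 => by
    rw [← h0, zero_mul] at h'; exact h'.not_ge (sq_nonneg _)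
  have hd : 0 < f - ‖c‖ ^ 2 / a := by rw [sub_pos, div_lt_iff₀ ha0]; linarith
  have he : 0 < 1 - f - ‖c‖ ^ 2 / (1 - a) := by rw [sub_pos, div_lt_iff₀ ha1]; linarith
  obtain ⟨α, hα, hα2⟩ : ∃ s : ℝ, 0 < s ∧ s ^ 2 = a := ⟨√a, by positivity, Real.sq_sqrt ha⟩
  obtain ⟨β, hβ, hβ2⟩ : ∃ s : ℝ, 0 < s ∧ s ^ 2 = 1 - a :=
    ⟨√(1 - a), by positivity, Real.sq_sqrt ha1.le⟩
  obtain ⟨δ, hδ, hδ2⟩ : ∃ s : ℝ, 0 < s ∧ s ^ 2 = f - ‖c‖ ^ 2 / a :=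
    ⟨√(f - ‖c‖ ^ 2 / a), by positivity, Real.sq_sqrt hd.le⟩
  obtain ⟨η, hη, hη2⟩ : ∃ s : ℝ, 0 < s ∧ s ^ 2 = 1 - f - ‖c‖ ^ 2 / (1 - a) :=
    ⟨√(1 - f - ‖c‖ ^ 2 / (1 - a)), by positivity, Real.sq_sqrt he.le⟩
  have hαc : (α : ℂ) ≠ 0 := by exact_mod_cast hα.ne'
  have hβc : (β : ℂ) ≠ 0 := by exact_mod_cast hβ.ne'
  set γ : ℂ := star c / α with hγ
  set ε : ℂ := -star c / β with hε
  have hc : α * star γ = c := by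
    simp only [hγ, Complex.star_def, map_div₀, Complex.conj_conj, Complex.conj_ofReal]
    field_simp
  have hc' : β * star ε = -c := by
    simp only [hε, Complex.star_def, map_div₀, map_neg, Complex.conj_conj, Complex.conj_ofReal]
    field_simp
  have hf : Complex.normSq γ + δ ^ 2 = f := by
    rw [hγ, Complex.normSq_div, Complex.star_def, Complex.normSq_conj, Complex.normSq_ofReal,
      ← sq, hα2, hδ2, Complex.normSq_eq_norm_sq]
    ring
  have hf' : Complex.normSq ε + η ^ 2 = 1 - f := by
    rw [hε, Complex.normSq_div, Complex.normSq_neg, Complex.star_def, Complex.normSq_conj,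
      Complex.normSq_ofReal, ← sq, hβ2, hη2, Complex.normSq_eq_norm_sq]
    ring
  have hW := isUnit_cholMat hα.ne' hβ.ne' hδ.ne' hη.ne' γ ε
  classical
  have key : ∀ k l m n : ℂ,
      channelInd (a, f, (α * β : ℝ) * k, c, (α * η : ℝ) * l + α * star ε * k,
        (β * δ : ℝ) * m + β * star γ * star k,
        (δ * η : ℝ) * n + (star ε * (γ * k + δ * star m) + η * γ * l)) =
      if (contractionMat k l m n).PosSemidef then 1 else 0 := by
    intro k l m n
    rw [channelInd, Set.indicator_apply, mem_qubitChannelSet,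
      choiAt_chol hα2 hβ2 hf hf' hc hc', hW.posSemidef_star_right_conjugate_iff]
    rfl
  have integral_g : ∀ k l m : ℂ, ∫⁻ g : ℂ, channelInd (a, f, (α * β : ℝ) * k, c,
      (α * η : ℝ) * l + α * star ε * k, (β * δ : ℝ) * m + β * star γ * star k, g) =
      ENNReal.ofReal ((δ * η) ^ 2) *
        ∫⁻ n : ℂ, if (contractionMat k l m n).PosSemidef then 1 else 0 := by
    intro k l m
    rw [lintegral_complex_affine _ (mul_pos hδ hη).ne'
      (star ε * (γ * k + δ * star m) + η * γ * l)]
    simp only [key]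
  have integral_e : ∀ k l : ℂ, ∫⁻ e : ℂ, ∫⁻ g : ℂ, channelInd (a, f, (α * β : ℝ) * k, c,
      (α * η : ℝ) * l + α * star ε * k, e, g) =
      ENNReal.ofReal ((β * δ) ^ 2) * (ENNReal.ofReal ((δ * η) ^ 2) * ∫⁻ m : ℂ,
        ∫⁻ n : ℂ, if (contractionMat k l m n).PosSemidef then 1 else 0) := by
    intro k l
    rw [lintegral_complex_affine _ (mul_pos hβ hδ).ne' (β * star γ * star k)]
    simp only [integral_g]
    rw [lintegral_const_mul' _ _ ENNReal.ofReal_ne_top]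
  have integral_d : ∀ k : ℂ, ∫⁻ d : ℂ, ∫⁻ e : ℂ, ∫⁻ g : ℂ, channelInd (a, f, (α * β : ℝ) * k, c,
      d, e, g) =
      ENNReal.ofReal ((α * η) ^ 2) * (ENNReal.ofReal ((β * δ) ^ 2) *
        (ENNReal.ofReal ((δ * η) ^ 2) * ∫⁻ l : ℂ, ∫⁻ m : ℂ,
        ∫⁻ n : ℂ, if (contractionMat k l m n).PosSemidef then 1 else 0)) := by
    intro k
    rw [lintegral_complex_affine _ (mul_pos hα hη).ne' (α * star ε * k)]
    simp only [integral_e]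
    rw [lintegral_const_mul' _ _ ENNReal.ofReal_ne_top,
      lintegral_const_mul' _ _ ENNReal.ofReal_ne_top]
  rw [lintegral_complex_affine _ (mul_pos hα hβ).ne' 0]
  simp only [add_zero, integral_d]
  rw [lintegral_const_mul' _ _ ENNReal.ofReal_ne_top,
    lintegral_const_mul' _ _ ENNReal.ofReal_ne_top,
    lintegral_const_mul' _ _ ENNReal.ofReal_ne_top, ← mul_assoc, ← mul_assoc, ← mul_assoc,
    ← ENNReal.ofReal_mul (by positivity), ← ENNReal.ofReal_mul (by positivity),
    ← ENNReal.ofReal_mul (by positivity)]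
  have h1 : α ^ 2 * δ ^ 2 = a * f - ‖c‖ ^ 2 := by rw [hα2, hδ2]; field_simp
  have h2 : β ^ 2 * η ^ 2 = (1 - a) * (1 - f) - ‖c‖ ^ 2 := by rw [hβ2, hη2]; field_simp
  rw [← h1, ← h2, contractionVolume]
  congr 2
  ring

lemma Matrix.PosSemidef.norm_sq_le {M : Matrix (Fin 4) (Fin 4) ℂ} (hM : M.PosSemidef)
    (i j : Fin 4) : ‖M i j‖ ^ 2 ≤ (M i i).re * (M j j).re := by
  have h := (hM.submatrix ![i, j]).det_nonneg
  have hji : M j i = star (M i j) := (hM.isHermitian.apply j i).symm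
  have hi := (Complex.nonneg_iff.1 (hM.diag_nonneg (i := i))).2
  have hj := (Complex.nonneg_iff.1 (hM.diag_nonneg (i := j))).2
  rw [Matrix.det_fin_two] at h
  simp only [Matrix.submatrix_apply, Matrix.cons_val_zero, Matrix.cons_val_one, hji,
    Complex.star_def, Complex.mul_conj] at h
  have h2 := (Complex.nonneg_iff.1 h).1
  rw [Complex.sub_re, Complex.mul_re, ← hi, zero_mul, sub_zero, Complex.ofReal_re,
    Complex.normSq_eq_norm_sq] at h2
  linarith

lemma lintegral_indicator_four {B : Set ℂ} (hB : MeasurableSet B) :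
    ∫⁻ k : ℂ, ∫⁻ l : ℂ, ∫⁻ m : ℂ, ∫⁻ n : ℂ,
      (B.indicator 1 k * (B.indicator 1 l * (B.indicator 1 m * B.indicator 1 n)) : ENNReal) =
      volume B * (volume B * (volume B * volume B)) := by
  have h : ∫⁻ n : ℂ, (B.indicator 1 n : ENNReal) = volume B := lintegral_indicator_one hB
  have hm : Measurable (B.indicator 1 : ℂ → ENNReal) := measurable_one.indicator hB
  have hne : ∀ z, (B.indicator 1 z : ENNReal) ≠ ⊤ := fun z => by
    classical
    rw [Set.indicator_apply]; split_ifs <;> simp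
  simp only [lintegral_const_mul' _ _ (hne _), lintegral_mul_const _ hm, h]

lemma contractionVolume_ne_top : contractionVolume ≠ ⊤ := by
  classical
  have hB := (Metric.isBounded_closedBall (x := (0 : ℂ)) (r := 1)).measure_lt_top
    (μ := (volume : Measure ℂ))
  refine ne_top_of_le_ne_top (b := _) ?_ ((lintegral_mono fun k => lintegral_mono fun l =>
    lintegral_mono fun m => lintegral_mono fun n => ?_).trans_eq
    (lintegral_indicator_four (B := Metric.closedBall 0 1)
    Metric.isClosed_closedBall.measurableSet))
  · exact ENNReal.mul_ne_top hB.ne (ENNReal.mul_ne_top hB.ne (ENNReal.mul_ne_top hB.ne hB.ne))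
  · split_ifs with hM
    · have hk := hM.norm_sq_le 0 1
      have hl := hM.norm_sq_le 0 3
      have hm := hM.norm_sq_le 1 2
      have hn := hM.norm_sq_le 2 3
      simp [contractionMat] at hk hl hm hn
      simp [hk, hl, hm, hn]
    · exact bot_le

lemma re_star_mul_mul_ge {k : ℂ} (hk : ‖k‖ ≤ 1 / 2) (x y : ℂ) :
    -(Complex.normSq x + Complex.normSq y) / 2 ≤ 2 * (star x * k * y).re := by
  have h1 := Complex.abs_re_le_norm (star x * k * y)
  rw [norm_mul, norm_mul, norm_star] at h1
  have h2 := neg_le_of_abs_le h1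
  have h3 : ‖x‖ * ‖k‖ * ‖y‖ ≤ ‖x‖ * (1 / 2) * ‖y‖ := by gcongr
  rw [Complex.normSq_eq_norm_sq, Complex.normSq_eq_norm_sq]
  nlinarith [sq_nonneg (‖x‖ - ‖y‖)]

lemma posSemidef_contractionMat {k l m n : ℂ} (hk : ‖k‖ ≤ 1 / 2) (hl : ‖l‖ ≤ 1 / 2)
    (hm : ‖m‖ ≤ 1 / 2) (hn : ‖n‖ ≤ 1 / 2) : (contractionMat k l m n).PosSemidef := by
  refine Matrix.PosSemidef.of_dotProduct_mulVec_nonneg ?_ fun x => ?_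
  · ext i j
    fin_cases i <;> fin_cases j <;> simp [contractionMat, Matrix.conjTranspose_apply]
  · have hre : ∀ z : ℂ, (z.re : ℂ) = (z + star z) / 2 := fun z => Complex.re_eq_add_conj z
    have hns : ∀ z : ℂ, (Complex.normSq z : ℂ) = z * star z := fun z => (Complex.mul_conj z).symm
    have : star x ⬝ᵥ contractionMat k l m n *ᵥ x =
        ((Complex.normSq (x 0) + Complex.normSq (x 1) + Complex.normSq (x 2)
          + Complex.normSq (x 3) + 2 * (star (x 0) * k * x 1).re + 2 * (star (x 0) * l * x 3).re
          + 2 * (star (x 1) * m * x 2).re + 2 * (star (x 2) * n * x 3).re : ℝ) : ℂ) := by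
      push_cast
      simp only [hre, hns, star_mul', star_star, dotProduct, Matrix.mulVec, Fin.sum_univ_four,
        contractionMat, Matrix.of_apply, Matrix.cons_val', Matrix.cons_val, Matrix.cons_val_zero,
        Matrix.cons_val_one, Pi.star_apply]
      ring
    rw [this, Complex.zero_le_real]
    linarith [re_star_mul_mul_ge hk (x 0) (x 1), re_star_mul_mul_ge hl (x 0) (x 3),
      re_star_mul_mul_ge hm (x 1) (x 2), re_star_mul_mul_ge hn (x 2) (x 3)]

lemma contractionVolume_ne_zero : contractionVolume ≠ 0 := by
  classical
  have hB : volume (Metric.closedBall (0 : ℂ) (1 / 2)) ≠ 0 :=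
    (Metric.measure_closedBall_pos volume 0 (by norm_num)).ne'
  refine ((pos_iff_ne_zero.2 ?_).trans_le ((lintegral_indicator_four
    (B := Metric.closedBall 0 (1 / 2)) Metric.isClosed_closedBall.measurableSet).symm.trans_le
    (lintegral_mono fun k => lintegral_mono fun l =>
    lintegral_mono fun m => lintegral_mono fun n => ?_))).ne'
  · exact mul_ne_zero hB (mul_ne_zero hB (mul_ne_zero hB hB))
  · by_cases h : ‖k‖ ≤ 1 / 2 ∧ ‖l‖ ≤ 1 / 2 ∧ ‖m‖ ≤ 1 / 2 ∧ ‖n‖ ≤ 1 / 2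
    · rw [if_pos (posSemidef_contractionMat h.1 h.2.1 h.2.2.1 h.2.2.2)]
      simp only [Set.indicator_apply, Metric.mem_closedBall, dist_zero_right, h.1, h.2.1, h.2.2.1,
        h.2.2.2, if_true, Pi.one_apply, mul_one, le_refl]
    · refine (le_of_eq (b := (0 : ENNReal)) ?_).trans zero_le
      simp only [Set.indicator_apply, Metric.mem_closedBall, dist_zero_right, Pi.one_apply]
      by_contra h0
      simp only [mul_eq_zero, not_or, ite_eq_right_iff, one_ne_zero, imp_false, not_not] at h0
      exact h h0

/-- The volume of the slice of the set of channels with prescribed `a`, `f` and `c` such that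
`‖c‖ = r`, relative to the volume of the set of contractions. -/
noncomputable def sliceDensity (a f r : ℝ) : ENNReal :=
  if 0 ≤ a ∧ a ≤ 1 ∧ r ^ 2 < a * f ∧ r ^ 2 < (1 - a) * (1 - f) then
    ENNReal.ofReal ((a * f - r ^ 2) ^ 2 * ((1 - a) * (1 - f) - r ^ 2) ^ 2) else 0

lemma measurable_sliceDensity : Measurable fun p : ℝ × ℝ × ℝ => sliceDensity p.1 p.2.1 p.2.2 := by
  refine Measurable.ite ?_ (by fun_prop) measurable_const
  rw [Set.ofPred_and, Set.ofPred_and, Set.ofPred_and]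
  refine .inter ?_ (.inter ?_ (.inter ?_ ?_))
  · exact measurableSet_le (by fun_prop) (by fun_prop)
  · exact measurableSet_le (by fun_prop) (by fun_prop)
  · exact measurableSet_lt (by fun_prop) (by fun_prop)
  · exact measurableSet_lt (by fun_prop) (by fun_prop)

lemma sliceDensity_one_sub (a f r : ℝ) :
    sliceDensity (1 - a) (1 - f) r = sliceDensity a f r := by
  unfold sliceDensity
  have h : (0 ≤ 1 - a ∧ 1 - a ≤ 1 ∧ r ^ 2 < (1 - a) * (1 - f) ∧
      r ^ 2 < (1 - (1 - a)) * (1 - (1 - f))) ↔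
      (0 ≤ a ∧ a ≤ 1 ∧ r ^ 2 < a * f ∧ r ^ 2 < (1 - a) * (1 - f)) := by
    simp only [sub_sub_cancel, sub_nonneg, sub_le_self_iff]
    tauto
  simp only [h]
  congr 2
  ring

/-- The integral of `sliceDensity` along the fibre `a + f - 1 = z`. -/
noncomputable def fibreVolume (z : ℝ) : ENNReal :=
  ∫⁻ a : ℝ, ∫⁻ c : ℂ, sliceDensity a (z + (1 - a)) ‖c‖

lemma fibreVolume_neg (z : ℝ) : fibreVolume (-z) = fibreVolume z := by
  unfold fibreVolume
  rw [← lintegral_sub_left_eq_self _ (1 : ℝ)]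
  refine lintegral_congr fun a => lintegral_congr fun c => ?_
  rw [← sliceDensity_one_sub a]
  congr 1
  ring

lemma lintegral_sliceDensity {z : ℝ} (hz : 0 ≤ z) (a : ℝ) :
    ∫⁻ c : ℂ, sliceDensity a (z + (1 - a)) ‖c‖ =
      (Set.Ioo z 1).indicator (fun a => ENNReal.ofReal (π * (((1 - a) * (a - z)) ^ 5 / 5 +
        z * ((1 - a) * (a - z)) ^ 4 / 2 + z ^ 2 * ((1 - a) * (a - z)) ^ 3 / 3))) a := by
  have hf1 : a * (z + (1 - a)) = (1 - a) * (a - z) + z := by ring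
  have hf2 : (1 - a) * (1 - (z + (1 - a))) = (1 - a) * (a - z) := by ring
  unfold sliceDensity
  rw [hf1, hf2]
  by_cases ha : a ∈ Set.Ioo z 1
  · rw [Set.indicator_of_mem ha]
    have h1 : 0 < 1 - a := sub_pos.2 ha.2
    have h2 : 0 < a - z := sub_pos.2 ha.1
    set q := (1 - a) * (a - z) with hq
    have hq0 : 0 < q := mul_pos h1 h2
    have hF : Measurable fun r : ℝ => if 0 ≤ a ∧ a ≤ 1 ∧ r ^ 2 < q + z ∧ r ^ 2 < q then
        ENNReal.ofReal ((q + z - r ^ 2) ^ 2 * (q - r ^ 2) ^ 2) else 0 := by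
      refine Measurable.ite ?_ (by fun_prop) measurable_const
      rw [Set.ofPred_and, Set.ofPred_and, Set.ofPred_and]
      refine .inter (.const _) (.inter (.const _) (.inter ?_ ?_))
      · exact measurableSet_lt (by fun_prop) (by fun_prop)
      · exact measurableSet_lt (by fun_prop) (by fun_prop)
    have h3 := lintegral_blochNorm hF 0
    have hn : ∀ c : ℂ, blochNorm (c, 0) = ‖c‖ := fun c => by
      simp [blochNorm, Complex.normSq_eq_norm_sq]
    simp only [hn] at h3
    rw [h3, abs_zero]
    have h4 : ∫⁻ r in Set.Ioi (0 : ℝ), ENNReal.ofReal r *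
        (if 0 ≤ a ∧ a ≤ 1 ∧ r ^ 2 < q + z ∧ r ^ 2 < q then
        ENNReal.ofReal ((q + z - r ^ 2) ^ 2 * (q - r ^ 2) ^ 2) else 0) =
        ∫⁻ r in Set.Ioo 0 √q, ENNReal.ofReal (r * ((q + z - r ^ 2) ^ 2 * (q - r ^ 2) ^ 2)) := by
      rw [← lintegral_indicator measurableSet_Ioi, ← lintegral_indicator measurableSet_Ioo]
      refine lintegral_congr fun r => ?_
      by_cases hr : 0 < r
      · rw [Set.indicator_of_mem (Set.mem_Ioi.2 hr)]
        by_cases hr2 : r < √q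
        · have := (Real.lt_sqrt hr.le).1 hr2
          rw [Set.indicator_of_mem (Set.mem_Ioo.2 ⟨hr, hr2⟩),
            if_pos ⟨hz.trans ha.1.le, ha.2.le, by linarith, this⟩, ← ENNReal.ofReal_mul hr.le]
        · rw [Set.indicator_of_notMem (fun h => hr2 (Set.mem_Ioo.1 h).2),
            if_neg (fun h => hr2 ((Real.lt_sqrt hr.le).2 h.2.2.2)), mul_zero]
      · rw [Set.indicator_of_notMem (fun h => hr (Set.mem_Ioi.1 h)),
        Set.indicator_of_notMem (fun h => hr (Set.mem_Ioo.1 h).1)]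
    rw [h4, lintegral_Ioo_eq_sub (F := fun r => -(1 / 2) * ((q - r ^ 2) ^ 5 / 5 +
      z * (q - r ^ 2) ^ 4 / 2 + z ^ 2 * (q - r ^ 2) ^ 3 / 3)) (Real.sqrt_nonneg q)]
    · rw [← ENNReal.ofReal_mul (by positivity), Real.sq_sqrt hq0.le]
      congr 1
      ring
    · intro r
      have hp := fun n : ℕ => ((hasDerivAt_pow 2 r).const_sub q).fun_pow n
      refine (((((hp 5).div_const 5).fun_add (((hp 4).const_mul z).div_const 2)).fun_add
        (((hp 3).const_mul (z ^ 2)).div_const 3)).const_mul (-(1 / 2))).congr_deriv ?_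
      push_cast
      ring
    · fun_prop
    · intro r hr
      have := hr.1
      positivity
  · rw [Set.indicator_of_notMem ha]
    refine lintegral_eq_zero_of_ae_eq_zero (Filter.Eventually.of_forall fun c => if_neg ?_)
    rintro ⟨h0, h1, -, h2⟩
    have h3 : 0 < (1 - a) * (a - z) := (sq_nonneg _).trans_lt h2
    have h4 : 0 < 1 - a := by
      rcases (sub_nonneg.2 h1).eq_or_lt with h | h
      · rw [← h, zero_mul] at h3; exact absurd h3 (lt_irrefl _)
      · exact h
    exact ha ⟨sub_pos.1 (pos_of_mul_pos_right h3 h4.le), sub_pos.1 h4⟩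

lemma fibreVolume_of_nonneg {z : ℝ} (hz : 0 ≤ z) :
    fibreVolume z = ENNReal.ofReal (π / 25200) * coordDensity z := by
  unfold fibreVolume
  simp only [lintegral_sliceDensity hz]
  rw [lintegral_indicator measurableSet_Ioo, coordDensity, abs_of_nonneg hz]
  split_ifs with hz1
  · have hw : ∀ a, 1 - a = (1 - z) - (a - z) := fun a => by ring
    rw [lintegral_Ioo_eq_sub (F := fun a => π * (
      ((1 - z) ^ 5 * (a - z) ^ 6 / 6 - 5 * (1 - z) ^ 4 * (a - z) ^ 7 / 7
        + 10 * (1 - z) ^ 3 * (a - z) ^ 8 / 8 - 10 * (1 - z) ^ 2 * (a - z) ^ 9 / 9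
        + 5 * (1 - z) * (a - z) ^ 10 / 10 - (a - z) ^ 11 / 11) / 5
      + z * ((1 - z) ^ 4 * (a - z) ^ 5 / 5 - 4 * (1 - z) ^ 3 * (a - z) ^ 6 / 6
        + 6 * (1 - z) ^ 2 * (a - z) ^ 7 / 7 - 4 * (1 - z) * (a - z) ^ 8 / 8
        + (a - z) ^ 9 / 9) / 2
      + z ^ 2 * ((1 - z) ^ 3 * (a - z) ^ 4 / 4 - 3 * (1 - z) ^ 2 * (a - z) ^ 5 / 5
        + 3 * (1 - z) * (a - z) ^ 6 / 6 - (a - z) ^ 7 / 7) / 3)) hz1.le]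
    · rw [← ENNReal.ofReal_mul (by positivity)]
      congr 1
      ring
    · intro a
      have hp := fun (n : ℕ) (k : ℝ) => (((hasDerivAt_id' a).sub_const z).fun_pow n).const_mul k
      have hq := fun (n : ℕ) (k m : ℝ) => (hp n k).div_const m
      have hs := ((hasDerivAt_id' a).sub_const z)
      refine (((((((((((hq 6 ((1 - z) ^ 5) 6).fun_sub (hq 7 (5 * (1 - z) ^ 4) 7)).fun_add
        (hq 8 (10 * (1 - z) ^ 3) 8)).fun_sub (hq 9 (10 * (1 - z) ^ 2) 9)).fun_add
        (hq 10 (5 * (1 - z)) 10)).fun_sub ((hs.fun_pow 11).div_const 11)).div_const 5).fun_add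
        ((((((((hq 5 ((1 - z) ^ 4) 5).fun_sub (hq 6 (4 * (1 - z) ^ 3) 6)).fun_add
        (hq 7 (6 * (1 - z) ^ 2) 7)).fun_sub (hq 8 (4 * (1 - z)) 8)).fun_add
        ((hs.fun_pow 9).div_const 9))).const_mul z).div_const 2)).fun_add
        (((((((hq 4 ((1 - z) ^ 3) 4).fun_sub (hq 5 (3 * (1 - z) ^ 2) 5)).fun_add
        (hq 6 (3 * (1 - z)) 6)).fun_sub ((hs.fun_pow 7).div_const 7))).const_mul
        (z ^ 2)).div_const 3)).const_mul π)).congr_deriv ?_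
      push_cast
      ring
    · fun_prop
    · intro a ha
      have h1 : 0 < 1 - a := sub_pos.2 ha.2
      have h2 : 0 < a - z := sub_pos.2 ha.1
      positivity
  · rw [Set.Ioo_eq_empty hz1, Measure.restrict_empty, lintegral_zero_measure, mul_zero]

lemma fibreVolume_eq (z : ℝ) :
    fibreVolume z = ENNReal.ofReal (π / 25200) * coordDensity z := by
  rcases le_total 0 z with hz | hz
  · exact fibreVolume_of_nonneg hz
  · rw [← fibreVolume_neg, fibreVolume_of_nonneg (neg_nonneg.2 hz), coordDensity, coordDensity,
      abs_neg]

lemma lintegral_coordDensity : ∫⁻ z, coordDensity z = 1 := by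
  have h1 : blochLaw Set.univ = ∫⁻ z, coordDensity z := by
    rw [← Set.preimage_univ (f := Prod.snd), ← Measure.map_apply measurable_snd MeasurableSet.univ,
      map_snd_blochLaw, withDensity_apply _ MeasurableSet.univ, setLIntegral_univ]
  rw [← h1, ← Set.preimage_univ (f := blochNorm),
    ← Measure.map_apply measurable_blochNorm MeasurableSet.univ, map_blochNorm_blochLaw,
    withDensity_apply _ MeasurableSet.univ, setLIntegral_univ]
  have h2 : (fun r : ℝ => if 0 ≤ r ∧ r ≤ 1 then ENNReal.ofReal
      (40 * r ^ 2 * (1 - r) ^ 6 * (r ^ 3 + 6 * r ^ 2 + 12 * r + 2)) else 0) =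
      (Set.Icc 0 1).indicator fun r : ℝ => ENNReal.ofReal
      (40 * r ^ 2 * (1 - r) ^ 6 * (r ^ 3 + 6 * r ^ 2 + 12 * r + 2)) := by
    ext r
    simp only [Set.indicator_apply, Set.mem_Icc]
  rw [h2, lintegral_indicator measurableSet_Icc, setLIntegral_congr Ioo_ae_eq_Icc.symm,
    lintegral_Ioo_eq_sub (F := fun r => 80 / 3 * r ^ 3 + -288 * r ^ 5 + 700 * r ^ 6
      + -720 * r ^ 7 + 315 * r ^ 8 + -36 * r ^ 10 + 10 / 3 * r ^ 12) zero_le_one]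
  · norm_num
  · intro r
    have hp := fun (n : ℕ) (k : ℝ) => (hasDerivAt_pow n r).const_mul k
    refine (((((((hp 3 (80 / 3)).fun_add (hp 5 (-288))).fun_add (hp 6 700)).fun_add
      (hp 7 (-720))).fun_add (hp 8 315)).fun_add (hp 10 (-36))).fun_add (hp 12 (10 / 3))).congr_deriv ?_
    push_cast
    ring
  · fun_prop
  · intro r hr
    have h1 : 0 < 1 - r := sub_pos.2 hr.2
    have h2 := hr.1
    positivity

instance isProbabilityMeasure_blochLaw : IsProbabilityMeasure blochLaw := by
  constructor
  rw [← lintegral_coordDensity, ← setLIntegral_univ, ← withDensity_apply _ MeasurableSet.univ,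
    ← map_snd_blochLaw, Measure.map_apply measurable_snd MeasurableSet.univ, Set.preimage_univ]

lemma lintegral_params {F : ℝ × ℝ × ℂ × ℂ × ℂ × ℂ × ℂ → ENNReal} (hF : Measurable F) :
    ∫⁻ p, F p = ∫⁻ a : ℝ, ∫⁻ f : ℝ, ∫⁻ c : ℂ, ∫⁻ b : ℂ, ∫⁻ d : ℂ, ∫⁻ e : ℂ, ∫⁻ g : ℂ,
      F (a, f, b, c, d, e, g) := by
  rw [Measure.volume_eq_prod, lintegral_prod _ hF.aemeasurable]
  refine lintegral_congr fun a => ?_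
  rw [Measure.volume_eq_prod, lintegral_prod (fun y => F (a, y)) (by fun_prop)]
  refine lintegral_congr fun f => ?_
  rw [Measure.volume_eq_prod, lintegral_prod (fun y => F (a, f, y)) (by fun_prop)]
  have h : ∀ b : ℂ, ∫⁻ y : ℂ × ℂ × ℂ × ℂ, F (a, f, b, y) =
      ∫⁻ c : ℂ, ∫⁻ w : ℂ × ℂ × ℂ, F (a, f, b, c, w) := fun b => by
    rw [Measure.volume_eq_prod, lintegral_prod (fun y => F (a, f, b, y)) (by fun_prop)]
  simp only [h]
  rw [lintegral_lintegral_swap]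
  · refine lintegral_congr fun c => lintegral_congr fun b => ?_
    rw [Measure.volume_eq_prod, lintegral_prod (fun y => F (a, f, b, c, y)) (by fun_prop)]
    refine lintegral_congr fun d => ?_
    rw [Measure.volume_eq_prod, lintegral_prod (fun y => F (a, f, b, c, d, y)) (by fun_prop)]
  · refine Measurable.aemeasurable ?_
    exact Measurable.lintegral_prod_right' (f := fun q : (ℂ × ℂ) × ℂ × ℂ × ℂ =>
      F (a, f, q.1.1, q.1.2, q.2)) (hF.comp (by fun_prop))

lemma lintegral_channelInd_of_not {a f : ℝ} {c : ℂ}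
    (h : ¬(0 ≤ a ∧ a ≤ 1 ∧ ‖c‖ ^ 2 ≤ a * f ∧ ‖c‖ ^ 2 ≤ (1 - a) * (1 - f))) :
    ∫⁻ b : ℂ, ∫⁻ d : ℂ, ∫⁻ e : ℂ, ∫⁻ g : ℂ, channelInd (a, f, b, c, d, e, g) = 0 := by
  have h0 : ∀ b d e g : ℂ, channelInd (a, f, b, c, d, e, g) = 0 := fun b d e g => by
    refine Set.indicator_of_notMem (fun hp => h ?_) _
    have h02 := hp.2.2.norm_sq_le 0 2
    have h13 := hp.2.2.norm_sq_le 1 3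
    simp [choiMat] at h02 h13
    exact ⟨hp.1.1, hp.1.2, h02, h13⟩
  simp only [h0, lintegral_zero]

lemma ae_norm_sq_ne (t : ℝ) : ∀ᵐ c : ℂ, ‖c‖ ^ 2 ≠ t := by
  refine measure_mono_null (fun c hc => ?_) (Measure.addHaar_sphere volume (0 : ℂ) √t)
  have hc' : ‖c‖ ^ 2 = t := not_not.1 hc
  rw [mem_sphere_zero_iff_norm, ← hc', Real.sqrt_sq (norm_nonneg c)]

lemma lintegral_channelInd (a f : ℝ) :
    (fun c : ℂ => ∫⁻ b : ℂ, ∫⁻ d : ℂ, ∫⁻ e : ℂ, ∫⁻ g : ℂ, channelInd (a, f, b, c, d, e, g))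
      =ᵐ[volume] fun c => sliceDensity a f ‖c‖ * contractionVolume := by
  filter_upwards [ae_norm_sq_ne (a * f), ae_norm_sq_ne ((1 - a) * (1 - f))] with c h1 h2
  unfold sliceDensity
  split_ifs with h
  · exact lintegral_channelInd_of_lt h.1 h.2.1 h.2.2.1 h.2.2.2
  · rw [zero_mul]
    refine lintegral_channelInd_of_not fun h' => h ?_
    exact ⟨h'.1, h'.2.1, lt_of_le_of_ne h'.2.2.1 h1, lt_of_le_of_ne h'.2.2.2 h2⟩

lemma setLIntegral_qubitChannelSet {G : ℝ → ENNReal} (hG : Measurable G) :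
    ∫⁻ p in qubitChannelSet, G (p.1 + p.2.1 - 1) =
      contractionVolume * ENNReal.ofReal (π / 25200) * ∫⁻ z, coordDensity z * G z := by
  have hI : Measurable channelInd := measurable_one.indicator measurableSet_qubitChannelSet
  have h1 : ∫⁻ p in qubitChannelSet, G (p.1 + p.2.1 - 1) =
      ∫⁻ p, channelInd p * G (p.1 + p.2.1 - 1) := by
    rw [← lintegral_indicator measurableSet_qubitChannelSet]
    refine lintegral_congr fun p => ?_
    by_cases hp : p ∈ qubitChannelSet <;> simp [channelInd, hp]
  have hs : ∀ a f : ℝ, Measurable fun c : ℂ => sliceDensity a f ‖c‖ := fun a f =>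
    measurable_sliceDensity.comp (f := fun c : ℂ => (a, f, ‖c‖)) (by fun_prop)
  have h2 : ∀ a f : ℝ, ∫⁻ c : ℂ, ∫⁻ b : ℂ, ∫⁻ d : ℂ, ∫⁻ e : ℂ, ∫⁻ g : ℂ,
      channelInd (a, f, b, c, d, e, g) * G (a + f - 1) =
      (∫⁻ c : ℂ, sliceDensity a f ‖c‖) * contractionVolume * G (a + f - 1) := fun a f => by
    have hm1 : ∀ b c d e, Measurable fun g => channelInd (a, f, b, c, d, e, g) :=
      fun b c d e => hI.comp (by fun_prop)
    have hm2 : ∀ b c d, Measurable fun e => ∫⁻ g : ℂ, channelInd (a, f, b, c, d, e, g) :=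
      fun b c d => Measurable.lintegral_prod_right' (f := fun q : ℂ × ℂ =>
        channelInd (a, f, b, c, d, q.1, q.2)) (hI.comp (by fun_prop))
    have hm3 : ∀ b c, Measurable fun d => ∫⁻ e : ℂ, ∫⁻ g : ℂ, channelInd (a, f, b, c, d, e, g) :=
      fun b c => Measurable.lintegral_prod_right' (f := fun q : ℂ × ℂ => ∫⁻ g : ℂ,
        channelInd (a, f, b, c, q.1, q.2, g)) (Measurable.lintegral_prod_right'
        (f := fun q : (ℂ × ℂ) × ℂ => channelInd (a, f, b, c, q.1.1, q.1.2, q.2))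
        (hI.comp (by fun_prop)))
    have hm4 : ∀ c, Measurable fun b => ∫⁻ d : ℂ, ∫⁻ e : ℂ, ∫⁻ g : ℂ,
        channelInd (a, f, b, c, d, e, g) :=
      fun c => Measurable.lintegral_prod_right' (f := fun q : ℂ × ℂ => ∫⁻ e : ℂ, ∫⁻ g : ℂ,
        channelInd (a, f, q.1, c, q.2, e, g)) (Measurable.lintegral_prod_right'
        (f := fun q : (ℂ × ℂ) × ℂ => ∫⁻ g : ℂ, channelInd (a, f, q.1.1, c, q.1.2, q.2, g))
        (Measurable.lintegral_prod_right'
        (f := fun q : ((ℂ × ℂ) × ℂ) × ℂ => channelInd (a, f, q.1.1.1, c, q.1.1.2, q.1.2, q.2))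
        (hI.comp (by fun_prop))))
    simp only [lintegral_mul_const _ (hm1 _ _ _ _), lintegral_mul_const _ (hm2 _ _ _),
      lintegral_mul_const _ (hm3 _ _), lintegral_mul_const _ (hm4 _)]
    have hae := (lintegral_channelInd a f).fun_comp (· * G (a + f - 1))
    simp only [Function.comp_def] at hae
    rw [lintegral_congr_ae hae,
      lintegral_mul_const _ ((hs a f).mul_const _), lintegral_mul_const _ (hs a f)]
  have hj : Measurable fun q : ℝ × ℝ => ∫⁻ c : ℂ, sliceDensity q.1 (q.2 + (1 - q.1)) ‖c‖ :=
    Measurable.lintegral_prod_right' (f := fun q : (ℝ × ℝ) × ℂ =>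
      sliceDensity q.1.1 (q.1.2 + (1 - q.1.1)) ‖q.2‖)
      (measurable_sliceDensity.comp (f := fun q : (ℝ × ℝ) × ℂ =>
        (q.1.1, q.1.2 + (1 - q.1.1), ‖q.2‖)) (by fun_prop))
  have h3 : ∀ a : ℝ, ∫⁻ f : ℝ, (∫⁻ c : ℂ, sliceDensity a f ‖c‖) * contractionVolume *
      G (a + f - 1) = ∫⁻ z : ℝ, (∫⁻ c : ℂ, sliceDensity a (z + (1 - a)) ‖c‖) *
      contractionVolume * G z := fun a => by
    rw [← lintegral_add_right_eq_self _ (1 - a)]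
    refine lintegral_congr fun z => ?_
    rw [show a + (z + (1 - a)) - 1 = z by ring]
  rw [h1, lintegral_params (F := fun p => channelInd p * G (p.1 + p.2.1 - 1))
    (hI.mul (hG.comp (by fun_prop)))]
  simp only [h2, h3]
  rw [lintegral_lintegral_swap, ← lintegral_const_mul _ (f := fun z => coordDensity z * G z)
    (measurable_coordDensity.mul hG)]
  · refine lintegral_congr fun z => ?_
    have hz : Measurable fun a : ℝ => ∫⁻ c : ℂ, sliceDensity a (z + (1 - a)) ‖c‖ :=
      hj.comp (f := fun a => (a, z)) (by fun_prop)
    rw [lintegral_mul_const _ (hz.mul_const _), lintegral_mul_const _ hz, ← fibreVolume,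
      fibreVolume_eq]
    ring
  · exact ((hj.mul_const _).mul (hG.comp measurable_snd)).aemeasurable

lemma volume_qubitChannelSet :
    volume qubitChannelSet = contractionVolume * ENNReal.ofReal (π / 25200) := by
  have h := setLIntegral_qubitChannelSet (G := fun _ => 1) measurable_const
  simpa only [setLIntegral_one, mul_one, lintegral_coordDensity] using h

lemma volume_qubitChannelSet_ne_zero : volume qubitChannelSet ≠ 0 := by
  rw [volume_qubitChannelSet]
  exact mul_ne_zero contractionVolume_ne_zero (ENNReal.ofReal_pos.2 (by positivity)).ne'

lemma volume_qubitChannelSet_ne_top : volume qubitChannelSet ≠ ⊤ := by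
  rw [volume_qubitChannelSet]
  exact ENNReal.mul_ne_top contractionVolume_ne_top ENNReal.ofReal_ne_top

instance isProbabilityMeasure_uniformQubitChannel : IsProbabilityMeasure uniformQubitChannel := by
  constructor
  rw [uniformQubitChannel, Measure.smul_apply, Measure.restrict_apply_univ, smul_eq_mul,
    ENNReal.inv_mul_cancel volume_qubitChannelSet_ne_zero volume_qubitChannelSet_ne_top]

lemma measurable_blochMap : Measurable blochMap := by
  unfold blochMap
  fun_prop

lemma map_blochMap_uniformQubitChannel : uniformQubitChannel.map blochMap = blochLaw := by
  have : IsFiniteMeasure (uniformQubitChannel.map blochMap) :=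
    Measure.isFiniteMeasure_map _ _
  refine IsotropicProjections.ext ?_ ?_ ?_
  · refine isotropicProjections_map measurable_blochMap fun α β h => ?_
    exact ⟨_, measurePreserving_rot h volume_qubitChannelSet_ne_zero
      volume_qubitChannelSet_ne_top, blochMap_rot_snd h⟩
  · exact isotropicProjections_radial measurable_blochDensity
  · rw [map_snd_blochLaw, Measure.map_map measurable_snd measurable_blochMap]
    refine Measure.ext_of_lintegral _ fun G hG => ?_
    rw [lintegral_map hG (measurable_snd.comp measurable_blochMap), uniformQubitChannel,
      lintegral_smul_measure, lintegral_withDensity_eq_lintegral_mul _ measurable_coordDensity hG]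
    simp only [Function.comp_apply, blochMap, Pi.mul_apply]
    rw [setLIntegral_qubitChannelSet hG, ← volume_qubitChannelSet, smul_eq_mul, ← mul_assoc,
      ENNReal.inv_mul_cancel volume_qubitChannelSet_ne_zero volume_qubitChannelSet_ne_top, one_mul]

/-- The Bloch radius `√(Re(b+g)² + Im(b+g)² + (a+f−1)²)` of the image of the maximally
mixed state under a uniformly random qubit channel has Lebesgue density
`κ(r) = 40 r² (1−r)⁶ (r³ + 6r² + 12r + 2)` on `[0,1]` and `0` outside. -/
theorem radius_density_maximally_mixed :
    Measure.map (fun p : ℝ × ℝ × ℂ × ℂ × ℂ × ℂ × ℂ =>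
        Real.sqrt ((p.2.2.1 + p.2.2.2.2.2.2).re ^ 2
          + (p.2.2.1 + p.2.2.2.2.2.2).im ^ 2 + (p.1 + p.2.1 - 1) ^ 2))
        uniformQubitChannel
      = volume.withDensity (fun r : ℝ => if 0 ≤ r ∧ r ≤ 1 then
          ENNReal.ofReal (40 * r ^ 2 * (1 - r) ^ 6 * (r ^ 3 + 6 * r ^ 2 + 12 * r + 2))
        else 0) := by
  rw [← map_blochNorm_blochLaw, ← map_blochMap_uniformQubitChannel,
    Measure.map_map measurable_blochNorm measurable_blochMap]
  congr 1
  ext p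
  simp only [Function.comp_apply, blochNorm, blochMap, Complex.normSq_apply, sq]
end

section
/- Fix r₀ ∈ (0,1] and let μ¹ be the uniform probability measure on the parameter set 𝒬̃¹ = {(a,b,c,d,e) ∈ [0,1] × ℂ⁴ : Q¹(a,b,c,d,e) is positive semidefinite} ⊂ ℝ⁹. Then the pushforward of μ¹ under the map (a,b,c,d,e) ↦ r₀(2a − 1) — the z-component of the image of the state with Bloch vector (0,0,r₀) — is the measure on ℝ with Lebesgue density f_{r₀}(z) = (315/256)·(r₀² − z²)⁴/r₀⁹ for z ∈ [−r₀, r₀] (and 0 outside [−r₀, r₀]). -/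
open MeasureTheory Matrix Real ComplexOrder

/-- The Choi matrix of a unital qubit channel with parameters `(a,b,c,d,e)`. -/
noncomputable def choiMatUnital (a : ℝ) (b c d e : ℂ) : Matrix (Fin 4) (Fin 4) ℂ :=
  !![(a : ℂ), b, c, d;
     star b, 1 - (a : ℂ), e, -c;
     star c, star e, 1 - (a : ℂ), -b;
     star d, -star c, -star b, (a : ℂ)]

/-- The parameter set of unital qubit channels, a Borel subset of `ℝ⁹`. -/
def unitalChannelSet : Set (ℝ × ℂ × ℂ × ℂ × ℂ) :=
  {p | p.1 ∈ Set.Icc (0 : ℝ) 1 ∧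
    (choiMatUnital p.1 p.2.1 p.2.2.1 p.2.2.2.1 p.2.2.2.2).PosSemidef}

/-- The uniform probability measure on the set of unital qubit channels. -/
noncomputable def uniformUnitalChannel : Measure (ℝ × ℂ × ℂ × ℂ × ℂ) :=
  (volume unitalChannelSet)⁻¹ • volume.restrict unitalChannelSet

theorem choiMatUnital_isHermitian (a : ℝ) (b c d e : ℂ) :
    (choiMatUnital a b c d e).IsHermitian := by
  ext i j
  fin_cases i <;> fin_cases j <;> simp [choiMatUnital]

theorem isClosed_setOf_posSemidef_s15 {n : Type*} [Fintype n] :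
    IsClosed {M : Matrix n n ℂ | M.PosSemidef} := by
  simp only [posSemidef_iff_dotProduct_mulVec, Set.ofPred_and, Set.ofPred_forall]
  refine IsClosed.inter ?_ (isClosed_iInter fun x => ?_)
  · exact isClosed_eq (by fun_prop) continuous_id
  · exact isClosed_le continuous_const (by fun_prop)

theorem isClosed_unitalChannelSet : IsClosed unitalChannelSet := by
  refine (isClosed_Icc.preimage continuous_fst).inter
    (isClosed_setOf_posSemidef_s15.preimage (f := fun p : ℝ × ℂ × ℂ × ℂ × ℂ =>
      choiMatUnital p.1 p.2.1 p.2.2.1 p.2.2.2.1 p.2.2.2.2) ?_)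
  refine continuous_matrix fun i j => ?_
  fin_cases i <;> fin_cases j <;> simp [choiMatUnital] <;> fun_prop

/-- The unital qubit channels with first parameter `a`. -/
def unitalSlice (a : ℝ) : Set (ℂ × ℂ × ℂ × ℂ) :=
  {q | (choiMatUnital a q.1 q.2.1 q.2.2.1 q.2.2.2).PosSemidef}

/-- The diagonal rescaling taking the slice at `1/2` to the slice at `a`. -/
noncomputable def sliceScaling (a : ℝ) : (ℂ × ℂ × ℂ × ℂ) →ₗ[ℝ] (ℂ × ℂ × ℂ × ℂ) :=
  ((√(2 * a) * √(2 * (1 - a))) • LinearMap.id).prodMap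
    (((√(2 * a) * √(2 * (1 - a))) • LinearMap.id).prodMap
      (((2 * a) • LinearMap.id).prodMap ((2 * (1 - a)) • LinearMap.id)))

theorem det_sliceScaling {a : ℝ} (ha : a ∈ Set.Ioo (0 : ℝ) 1) :
    LinearMap.det (sliceScaling a) = 256 * (a * (1 - a)) ^ 4 := by
  have h1 : √(2 * a) ^ 2 = 2 * a := Real.sq_sqrt (by linarith [ha.1])
  have h2 : √(2 * (1 - a)) ^ 2 = 2 * (1 - a) := Real.sq_sqrt (by linarith [ha.2])
  simp only [sliceScaling, LinearMap.det_prodMap, LinearMap.det_smul, LinearMap.det_id,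
    Complex.finrank_real_complex, mul_pow, h1, h2]
  ring

theorem choiMatUnital_sliceScaling {a : ℝ} (ha : a ∈ Set.Ioo (0 : ℝ) 1) (b c d e : ℂ) :
    let D : Matrix (Fin 4) (Fin 4) ℂ := diagonal
      ![(√(2 * a) : ℂ), (√(2 * (1 - a)) : ℂ), (√(2 * (1 - a)) : ℂ), (√(2 * a) : ℂ)]
    let q := sliceScaling a (b, c, d, e)
    choiMatUnital a q.1 q.2.1 q.2.2.1 q.2.2.2 = star D * choiMatUnital (1 / 2) b c d e * D := by
  have h1 : ((√(2 * a) : ℝ) : ℂ) * (√(2 * a) : ℝ) = 2 * a := by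
    exact_mod_cast Real.mul_self_sqrt (by linarith [ha.1] : 0 ≤ 2 * a)
  have h2 : ((√(2 * (1 - a)) : ℝ) : ℂ) * (√(2 * (1 - a)) : ℝ) = 2 * (1 - a) := by
    exact_mod_cast Real.mul_self_sqrt (by linarith [ha.2] : 0 ≤ 2 * (1 - a))
  simp only [sliceScaling]
  generalize √(2 * a) = s at *
  generalize √(2 * (1 - a)) = t at *
  ext i j
  fin_cases i <;> fin_cases j <;>
    simp [choiMatUnital, star_eq_conjTranspose, diagonal_conjTranspose, mul_diagonal,
      diagonal_mul, -mul_eq_mul_left_iff, -mul_eq_mul_right_iff] <;> grind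

theorem preimage_sliceScaling {a : ℝ} (ha : a ∈ Set.Ioo (0 : ℝ) 1) :
    sliceScaling a ⁻¹' unitalSlice a = unitalSlice (1 / 2) := by
  ext ⟨b, c, d, e⟩
  simp only [Set.mem_preimage, unitalSlice, Set.mem_ofPred_eq]
  rw [choiMatUnital_sliceScaling ha]
  refine IsUnit.posSemidef_star_left_conjugate_iff ?_
  have h1 : √(2 * a) ≠ 0 := (Real.sqrt_pos.2 (by linarith [ha.1])).ne'
  have h2 : √(2 * (1 - a)) ≠ 0 := (Real.sqrt_pos.2 (by linarith [ha.2])).ne'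
  rw [Matrix.isUnit_iff_isUnit_det, det_diagonal, Fin.prod_univ_four, isUnit_iff_ne_zero]
  simpa [-Nat.ofNat_nonneg, -Real.sqrt_mul, -Real.sqrt_mul', ← Complex.ofReal_mul] using
    And.intro (And.intro h1 h2) h1

instance : (volume : Measure (ℂ × ℂ × ℂ × ℂ)).IsAddHaarMeasure :=
  haveI : (volume : Measure (ℂ × ℂ)).IsAddHaarMeasure :=
    Measure.prod.instIsAddHaarMeasure volume volume
  haveI : (volume : Measure (ℂ × ℂ × ℂ)).IsAddHaarMeasure :=
    Measure.prod.instIsAddHaarMeasure volume volume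
  Measure.prod.instIsAddHaarMeasure volume volume

theorem volume_unitalSlice {a : ℝ} (ha : a ∈ Set.Ioo (0 : ℝ) 1) :
    volume (unitalSlice a)
      = volume (unitalSlice (1 / 2)) * ENNReal.ofReal (256 * (a * (1 - a)) ^ 4) := by
  have hpos : 0 < 256 * (a * (1 - a)) ^ 4 := by
    have := mul_pos ha.1 (sub_pos.2 ha.2)
    positivity
  have h := Measure.addHaar_preimage_linearMap volume (f := sliceScaling a)
    (by rw [det_sliceScaling ha]; exact hpos.ne') (unitalSlice a)
  rw [preimage_sliceScaling ha, det_sliceScaling ha, abs_of_pos (inv_pos.2 hpos),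
    ENNReal.ofReal_inv_of_pos hpos] at h
  rw [h, mul_comm, ← mul_assoc, ENNReal.mul_inv_cancel (by simpa using hpos) ENNReal.ofReal_ne_top, one_mul]

theorem unitalSlice_half_subset : unitalSlice (1 / 2) ⊆ Metric.closedBall 0 1 := by
  rintro ⟨b, c, d, e⟩ h
  have key (i j : Fin 4) : ‖choiMatUnital (1 / 2) b c d e i j‖ ≤ 1 := by
    have hdiag (k : Fin 4) : choiMatUnital (1 / 2) b c d e k k = 1 / 2 := by
      fin_cases k <;> simp [choiMatUnital] <;> norm_num
    have hdet := (PosSemidef.submatrix h ![i, j]).det_nonneg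
    have hji : choiMatUnital (1 / 2) b c d e j i = star (choiMatUnital (1 / 2) b c d e i j) :=
      ((choiMatUnital_isHermitian _ _ _ _ _).apply _ _).symm
    simp only [det_fin_two, submatrix_apply, cons_val_zero, cons_val_one, hdiag] at hdet
    rw [hji, Complex.star_def, Complex.mul_conj, Complex.normSq_eq_norm_sq] at hdet
    have hre : 0 ≤ 1 / 2 * (1 / 2) - ‖choiMatUnital (1 / 2) b c d e i j‖ ^ 2 := by
      rw [← Complex.zero_le_real]
      push_cast at hdet ⊢
      exact hdet
    nlinarith [norm_nonneg (choiMatUnital (1 / 2) b c d e i j)]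
  have hb := key 0 1
  have hc := key 0 2
  have hd := key 0 3
  have he := key 1 2
  simp only [choiMatUnital] at hb hc hd he
  simp at hb hc hd he
  simp [Prod.norm_def, hb, hc, hd, he]

theorem neg_le_two_mul_re_star_mul_mul {m : ℂ} (hm : ‖m‖ < 1 / 6) (x y : ℂ) :
    -(‖x‖ ^ 2 + ‖y‖ ^ 2) / 6 ≤ 2 * (star x * (m * y)).re := by
  have h : |(star x * (m * y)).re| ≤ ‖x‖ * (‖m‖ * ‖y‖) := by
    simpa using Complex.abs_re_le_norm (star x * (m * y))
  have h' : ‖m‖ * (‖x‖ * ‖y‖) ≤ 1 / 6 * (‖x‖ * ‖y‖) := by gcongr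
  nlinarith [neg_le_of_abs_le h, sq_nonneg (‖x‖ - ‖y‖)]

theorem ball_subset_unitalSlice_half : Metric.ball 0 (1 / 6) ⊆ unitalSlice (1 / 2) := by
  rintro ⟨b, c, d, e⟩ h
  simp only [mem_ball_zero_iff, Prod.norm_def, sup_lt_iff] at h
  obtain ⟨hb, hc, hd, he⟩ := h
  refine PosSemidef.of_dotProduct_mulVec_nonneg (choiMatUnital_isHermitian _ _ _ _ _) fun x => ?_
  rw [RCLike.nonneg_iff]
  refine ⟨?_, (choiMatUnital_isHermitian _ _ _ _ _).im_star_dotProduct_mulVec_self x⟩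
  have h01 := neg_le_two_mul_re_star_mul_mul hb (x 0) (x 1)
  have h02 := neg_le_two_mul_re_star_mul_mul hc (x 0) (x 2)
  have h03 := neg_le_two_mul_re_star_mul_mul hd (x 0) (x 3)
  have h12 := neg_le_two_mul_re_star_mul_mul he (x 1) (x 2)
  have h13 := neg_le_two_mul_re_star_mul_mul (by rwa [norm_neg] : ‖-c‖ < 1 / 6) (x 1) (x 3)
  have h23 := neg_le_two_mul_re_star_mul_mul (by rwa [norm_neg] : ‖-b‖ < 1 / 6) (x 2) (x 3)
  simp only [← Complex.normSq_eq_norm_sq, Complex.normSq_apply] at h01 h02 h03 h12 h13 h23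
  simp [dotProduct, mulVec, Fin.sum_univ_four, choiMatUnital] at h01 h02 h03 h12 h13 h23 ⊢
  linarith

theorem volume_unitalSlice_half_ne_top : volume (unitalSlice (1 / 2)) ≠ ⊤ :=
  ((measure_mono unitalSlice_half_subset).trans_lt measure_closedBall_lt_top).ne

theorem volume_unitalSlice_half_ne_zero : volume (unitalSlice (1 / 2)) ≠ 0 :=
  ((Metric.measure_ball_pos volume 0 (by norm_num)).trans_le
    (measure_mono ball_subset_unitalSlice_half)).ne'

theorem volume_unitalChannelSet_inter {B : Set ℝ} (hB : MeasurableSet B) :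
    volume (Prod.fst ⁻¹' B ∩ unitalChannelSet)
      = volume (unitalSlice (1 / 2)) *
        ∫⁻ a in B, (Set.Icc (0 : ℝ) 1).indicator
          (fun a => ENNReal.ofReal (256 * (a * (1 - a)) ^ 4)) a := by
  rw [Measure.volume_eq_prod, Measure.prod_apply
    ((measurable_fst hB).inter isClosed_unitalChannelSet.measurableSet),
    ← lintegral_const_mul' _ _ volume_unitalSlice_half_ne_top, ← lintegral_indicator hB]
  refine lintegral_congr_ae ?_
  have h01 : ∀ᵐ a : ℝ, a ∉ ({0, 1} : Set ℝ) :=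
    measure_eq_zero_iff_ae_notMem.1 ((Set.toFinite _).measure_zero _)
  filter_upwards [h01] with a ha
  by_cases haB : a ∈ B
  · by_cases haI : a ∈ Set.Icc (0 : ℝ) 1
    · have haO : a ∈ Set.Ioo (0 : ℝ) 1 := by
        simp only [Set.mem_insert_iff, Set.mem_singleton_iff, not_or] at ha
        exact ⟨haI.1.lt_of_ne' ha.1, haI.2.lt_of_ne ha.2⟩
      rw [Set.indicator_of_mem haB, Set.indicator_of_mem haI, ← volume_unitalSlice haO]
      congr 1
      ext q
      simp [unitalChannelSet, unitalSlice, haB, haI.1, haI.2]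
    · rw [Set.indicator_of_mem haB, Set.indicator_of_notMem haI, mul_zero]
      convert measure_empty (μ := volume) using 2
      ext q
      simp only [unitalChannelSet, Set.mem_preimage, Set.mem_inter_iff, Set.mem_ofPred_eq, haI]
      simp
  · rw [Set.indicator_of_notMem haB]
    convert measure_empty (μ := volume) using 2
    ext q
    simp [haB]

theorem lintegral_indicator_Icc_pow :
    ∫⁻ a, (Set.Icc (0 : ℝ) 1).indicator
      (fun a => ENNReal.ofReal (256 * (a * (1 - a)) ^ 4)) a = ENNReal.ofReal (256 / 630) := by
  rw [lintegral_indicator measurableSet_Icc, ← ofReal_integral_eq_lintegral_ofReal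
    (Continuous.integrableOn_Icc (by fun_prop)) (.of_forall fun a => by positivity),
    integral_Icc_eq_integral_Ioc, ← intervalIntegral.integral_of_le zero_le_one]
  congr 1
  have : (fun a : ℝ => 256 * (a * (1 - a)) ^ 4) = fun a =>
      256 * a ^ 4 - 1024 * a ^ 5 + 1536 * a ^ 6 - 1024 * a ^ 7 + 256 * a ^ 8 := by
    ext a; ring
  rw [this]
  have hd (x : ℝ) : HasDerivAt (fun a : ℝ => 256 / 5 * a ^ 5 - 1024 / 6 * a ^ 6 + 1536 / 7 * a ^ 7
      - 1024 / 8 * a ^ 8 + 256 / 9 * a ^ 9)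
      (256 * x ^ 4 - 1024 * x ^ 5 + 1536 * x ^ 6 - 1024 * x ^ 7 + 256 * x ^ 8) x := by
    convert! (((((hasDerivAt_pow 5 x).const_mul (256 / 5)).sub
      ((hasDerivAt_pow 6 x).const_mul (1024 / 6))).add
      ((hasDerivAt_pow 7 x).const_mul (1536 / 7))).sub
      ((hasDerivAt_pow 8 x).const_mul (1024 / 8))).add
      ((hasDerivAt_pow 9 x).const_mul (256 / 9)) using 1
    norm_num
    ring
  rw [intervalIntegral.integral_eq_sub_of_hasDerivAt (fun x _ => hd x)
    (Continuous.intervalIntegrable (by fun_prop) _ _)]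
  norm_num

theorem volume_eq_smul_map_affine {r : ℝ} (hr : 0 < r) :
    (volume : Measure ℝ)
      = ENNReal.ofReal (2 * r) • Measure.map (fun a : ℝ => r * (2 * a - 1)) volume := by
  have h : (fun a : ℝ => r * (2 * a - 1)) = (fun a => a + -r) ∘ fun a => (2 * r) * a := by
    ext a; simp; ring
  rw [h, ← Measure.map_map (by fun_prop) (by fun_prop),
    Real.map_volume_mul_left (by positivity), Measure.map_smul,
    map_add_right_eq_self, smul_smul, ← ENNReal.ofReal_mul (by positivity),
    abs_of_pos (by positivity), mul_inv_cancel₀ (by positivity)]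
  simp

/-- For `r₀ ∈ (0,1]`, the `z`-component `r₀(2a−1)` of the image of the state with Bloch
vector `(0,0,r₀)` under a uniformly random unital qubit channel has Lebesgue density
`f_{r₀}(z) = (315/256)(r₀² − z²)⁴/r₀⁹` on `[−r₀, r₀]` and `0` outside. -/
theorem z_density_unital (r₀ : ℝ) (hr₀ : r₀ ∈ Set.Ioc (0 : ℝ) 1) :
    Measure.map (fun p : ℝ × ℂ × ℂ × ℂ × ℂ => r₀ * (2 * p.1 - 1))
        uniformUnitalChannel
      = volume.withDensity (fun z : ℝ => if |z| ≤ r₀ then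
          ENNReal.ofReal ((315 / 256) * (r₀ ^ 2 - z ^ 2) ^ 4 / r₀ ^ 9)
        else 0) := by
  obtain ⟨hr, -⟩ := hr₀
  have hh : Measurable fun a : ℝ => r₀ * (2 * a - 1) := by fun_prop
  set f : ℝ → ENNReal := fun z => if |z| ≤ r₀ then
    ENNReal.ofReal ((315 / 256) * (r₀ ^ 2 - z ^ 2) ^ 4 / r₀ ^ 9) else 0 with hf_def
  have hf : Measurable f :=
    Measurable.ite (measurableSet_le (by fun_prop) (by fun_prop)) (by fun_prop) (by fun_prop)
  have hpt (a : ℝ) : ENNReal.ofReal (2 * r₀) * f (r₀ * (2 * a - 1))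
      = (ENNReal.ofReal (256 / 630))⁻¹ * (Set.Icc (0 : ℝ) 1).indicator
          (fun a => ENNReal.ofReal (256 * (a * (1 - a)) ^ 4)) a := by
    have hiff : |r₀ * (2 * a - 1)| ≤ r₀ ↔ a ∈ Set.Icc (0 : ℝ) 1 := by
      rw [abs_mul, abs_of_pos hr, mul_le_iff_le_one_right hr, abs_le, Set.mem_Icc]
      constructor <;> rintro ⟨h1, h2⟩ <;> constructor <;> linarith
    by_cases ha : a ∈ Set.Icc (0 : ℝ) 1
    · rw [hf_def, Set.indicator_of_mem ha]
      simp only [if_pos (hiff.2 ha)]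
      rw [← ENNReal.ofReal_inv_of_pos (by norm_num), ← ENNReal.ofReal_mul (by positivity),
        ← ENNReal.ofReal_mul (by norm_num)]
      congr 1
      field_simp
      ring
    · rw [hf_def, Set.indicator_of_notMem ha]
      simp only [if_neg (mt hiff.1 ha), mul_zero]
  have hC := volume_unitalSlice_half_ne_top
  have hC0 := volume_unitalSlice_half_ne_zero
  have hZ : volume unitalChannelSet
      = volume (unitalSlice (1 / 2)) * ENNReal.ofReal (256 / 630) := by
    have := volume_unitalChannelSet_inter MeasurableSet.univ
    rwa [Set.preimage_univ, Set.univ_inter, Measure.restrict_univ,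
      lintegral_indicator_Icc_pow] at this
  ext A hA
  have hB := hh hA
  rw [Measure.map_apply (f := fun p : ℝ × ℂ × ℂ × ℂ × ℂ => r₀ * (2 * p.1 - 1)) (by fun_prop) hA,
    uniformUnitalChannel, Measure.smul_apply, Measure.restrict_apply (by measurability),
    show (fun p : ℝ × ℂ × ℂ × ℂ × ℂ => r₀ * (2 * p.1 - 1)) ⁻¹' A
      = Prod.fst ⁻¹' ((fun a : ℝ => r₀ * (2 * a - 1)) ⁻¹' A) from rfl,
    volume_unitalChannelSet_inter hB, withDensity_apply _ hA, hZ, smul_eq_mul]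
  conv_rhs => rw [volume_eq_smul_map_affine hr]
  rw [Measure.restrict_smul, lintegral_smul_measure, Measure.restrict_map hh hA,
    lintegral_map hf hh, smul_eq_mul, ← lintegral_const_mul' _ _ ENNReal.ofReal_ne_top]
  simp_rw [hpt]
  rw [lintegral_const_mul' _ _ (by simp), ENNReal.mul_inv (.inl hC0) (.inl hC),
    mul_mul_mul_comm, ENNReal.inv_mul_cancel hC0 hC, one_mul]
end
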